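/- arXiv:math/0703749 — 6 statements merged into one kernel-verified Lean document; each statement's English description precedes it below -/
import Mathlib

section
/- Let 0 < θ < 1/140 and C > 0, and fix 0 < β < α ≤ 1. For each prime N, let W be a random subset of Z_N with parameter p = p(N) ∈ (CN^{-θ}, 1]. Then for every ε > 0 there is N₀ such that for all primes N ≥ N₀, the probability that the following holds is at least 1 − ε: for every set A ⊆ W with |A| ≥ α|W|, the sumset A + A = {a + a' : a, a' ∈ A} (computed in Z_N) satisfies |A + A| ≥ βN. -/
open scoped Classical BigOperators Pointwise

/-- The probability, under the product Bernoulli(p) measure on subsets of `ZMod N`,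
of the event `E` of subsets of `ZMod N`. -/
noncomputable def randomSetProb (N : ℕ) [NeZero N] (p : ℝ)
    (E : Finset (ZMod N) → Prop) : ℝ :=
  ∑ W ∈ (Finset.univ : Finset (ZMod N)).powerset,
    if E W then p ^ W.card * (1 - p) ^ (N - W.card) else 0

/-- If `B` misses `A + S`, then `A` lies in the complement of `T - S` for some small `T`, and this
complement is at most slightly larger than the complement of `B`. -/
lemma exists_small_container {G : Type*} [AddCommGroup G] [Fintype G] [DecidableEq G]
    {A B S : Finset G} {k : ℕ} {δ : ℝ} (hδ : 0 < δ) (hk : 0 < k) (hS : S.card = k)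
    (hB : Disjoint B (A + S)) (hkδ : (Fintype.card G : ℝ) ≤ δ * k ^ 2) :
    ∃ T : Finset G, T.card ≤ k ∧ A ⊆ (T - S)ᶜ ∧
      (((T - S)ᶜ.card : ℕ) : ℝ) + B.card ≤ (1 + δ) * Fintype.card G := by
  have hk' : (0 : ℝ) < k := by exact_mod_cast hk
  obtain ⟨T, hT, hmax⟩ := Finset.exists_max_image
    (B.powerset.filter fun T => δ * k * T.card ≤ ((T - S).card : ℝ)) Finset.card
    ⟨∅, by simp⟩
  simp only [Finset.mem_filter, Finset.mem_powerset] at hT hmax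
  refine ⟨T, ?_, ?_, ?_⟩
  · have h1 : ((T - S).card : ℝ) ≤ Fintype.card G := by exact_mod_cast Finset.card_le_univ _
    have h2 : δ * k * T.card ≤ δ * k * k := by nlinarith [hT.2]
    exact_mod_cast le_of_mul_le_mul_left h2 (by positivity)
  · intro a ha
    rw [Finset.mem_compl, Finset.mem_sub]
    rintro ⟨t, ht, s, hs, rfl⟩
    exact Finset.disjoint_left.mp hB (hT.1 ht) (Finset.mem_add.mpr ⟨_, ha, s, hs, by abel⟩)
  · set P := (T - S)ᶜ with hP
    have hdeg : ∀ z ∈ B, ((S.filter fun s => z - s ∈ P).card : ℝ) ≤ δ * k := by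
      intro z hz
      by_contra! hlt
      have hcard : ((({z} : Finset G) - S) \ (T - S)).card =
          (S.filter fun s => z - s ∈ P).card := by
        symm
        refine Finset.card_bij (fun s _ => z - s) ?_ ?_ ?_
        · intro s hs
          rw [Finset.mem_filter, hP, Finset.mem_compl] at hs
          exact Finset.mem_sdiff.mpr ⟨Finset.sub_mem_sub (Finset.mem_singleton_self z) hs.1, hs.2⟩
        · intro a _ b _ h
          exact sub_right_injective h
        · intro b hb
          rw [Finset.mem_sdiff, Finset.mem_sub] at hb
          obtain ⟨⟨z', hz', s, hs, rfl⟩, h⟩ := hb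
          rw [Finset.mem_singleton] at hz'
          subst hz'
          exact ⟨s, Finset.mem_filter.mpr ⟨hs, by rwa [hP, Finset.mem_compl]⟩, rfl⟩
      have hzT : z ∉ T := by
        intro hzT
        have : (({z} : Finset G) - S) \ (T - S) = ∅ :=
          Finset.sdiff_eq_empty_iff_subset.mpr
            (Finset.sub_subset_sub_right (Finset.singleton_subset_iff.mpr hzT))
        rw [this, Finset.card_empty] at hcard
        rw [← hcard, Nat.cast_zero] at hlt
        exact absurd hlt (not_lt.mpr (by positivity))
      have hunion : insert z T - S = (({z} : Finset G) - S) \ (T - S) ∪ (T - S) := by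
        rw [Finset.insert_eq, Finset.union_sub, Finset.sdiff_union_self_eq_union]
      have hle := hmax (insert z T) ⟨Finset.insert_subset hz hT.1, by
        rw [hunion, Finset.card_union_of_disjoint Finset.sdiff_disjoint, hcard,
          Finset.card_insert_of_notMem hzT]
        push_cast
        nlinarith [hT.2]⟩
      rw [Finset.card_insert_of_notMem hzT] at hle
      omega
    have hdouble : ∑ z ∈ B, (S.filter fun s => z - s ∈ P).card =
        ∑ s ∈ S, (B.filter fun z => z - s ∈ P).card :=
      Finset.sum_card_bipartiteAbove_eq_sum_card_bipartiteBelow fun z s => z - s ∈ P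
    have hlow : ∀ s ∈ S, P.card + B.card ≤
        (B.filter fun z => z - s ∈ P).card + Fintype.card G := by
      intro s _
      have h1 : B.filter (fun z => z - s ∈ P) = B ∩ P.image (· + s) := by
        ext z
        simp only [Finset.mem_filter, Finset.mem_inter, Finset.mem_image, and_congr_right_iff]
        exact fun _ => ⟨fun h => ⟨_, h, by abel⟩, by rintro ⟨x, hx, rfl⟩; simpa using hx⟩
      have h2 := Finset.card_union_add_card_inter B (P.image (· + s))
      rw [Finset.card_image_of_injective _ (add_left_injective s)] at h2
      have h3 := Finset.card_le_univ (B ∪ P.image (· + s))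
      rw [h1]
      omega
    have hup : (∑ z ∈ B, (S.filter fun s => z - s ∈ P).card : ℝ) ≤ Fintype.card G * (δ * k) := by
      refine (Finset.sum_le_card_nsmul _ _ _ hdeg).trans ?_
      rw [nsmul_eq_mul]
      have : (B.card : ℝ) ≤ Fintype.card G := by exact_mod_cast Finset.card_le_univ _
      gcongr
    have hlow' := Finset.card_nsmul_le_sum S _ _ hlow
    rw [Finset.sum_add_distrib, ← hdouble, Finset.sum_const, hS, smul_eq_mul, smul_eq_mul] at hlow'
    have hlow'' : (k : ℝ) * (P.card + B.card) ≤
        (∑ z ∈ B, ((S.filter fun s => z - s ∈ P).card : ℝ)) + k * Fintype.card G := by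
      exact_mod_cast hlow'
    refine le_of_mul_le_mul_left ?_ hk'
    linarith

lemma card_filter_card_le {G : Type*} [Fintype G] (hG : 1 ≤ Fintype.card G) (k : ℕ) :
    ((Finset.univ : Finset (Finset G)).filter fun S => S.card ≤ k).card ≤
      (k + 1) * Fintype.card G ^ k := by
  have h : (Finset.univ : Finset (Finset G)).filter (fun S => S.card ≤ k) ⊆
      (Finset.range (k + 1)).biUnion fun i => Finset.powersetCard i Finset.univ := by
    intro S hS
    simp only [Finset.mem_filter, Finset.mem_biUnion, Finset.mem_range] at hS ⊢
    exact ⟨S.card, by omega, by simp [Finset.mem_powersetCard]⟩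
  refine (Finset.card_le_card h).trans (Finset.card_biUnion_le.trans ?_)
  refine (Finset.sum_le_card_nsmul _ _ (Fintype.card G ^ k) ?_).trans (by simp)
  intro i hi
  rw [Finset.card_powersetCard, Finset.card_univ]
  exact (Nat.choose_le_pow _ _).trans
    (Nat.pow_le_pow_right hG (by simpa [Nat.lt_succ_iff] using hi))

/-- Exponential moments of an additive statistic of a random set. -/
lemma sum_bernoulli_mul_exp_le (N : ℕ) [NeZero N] {p : ℝ} (hp : 0 ≤ p) (hp1 : p ≤ 1)
    (u : ZMod N → ℝ) :
    ∑ W ∈ (Finset.univ : Finset (ZMod N)).powerset,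
      p ^ W.card * (1 - p) ^ (N - W.card) * Real.exp (∑ x ∈ W, u x) ≤
      Real.exp (p * ∑ x, (Real.exp (u x) - 1)) := by
  have h := Finset.prod_add (fun x => p * Real.exp (u x)) (fun _ => 1 - p)
    (Finset.univ : Finset (ZMod N))
  have h' : ∑ W ∈ (Finset.univ : Finset (ZMod N)).powerset,
      p ^ W.card * (1 - p) ^ (N - W.card) * Real.exp (∑ x ∈ W, u x) =
      ∏ x : ZMod N, (p * Real.exp (u x) + (1 - p)) := by
    rw [h]
    refine Finset.sum_congr rfl fun W _ => ?_
    rw [Finset.prod_mul_distrib, Finset.prod_const, Finset.prod_const, Real.exp_sum,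
      Finset.card_sdiff_of_subset (Finset.subset_univ W), Finset.card_univ, ZMod.card]
    ring
  rw [h', Finset.mul_sum, Real.exp_sum]
  refine Finset.prod_le_prod (fun x _ => ?_) fun x _ => ?_
  · have := Real.exp_pos (u x)
    have : 0 ≤ 1 - p := by linarith
    positivity
  · have := Real.add_one_le_exp (p * (Real.exp (u x) - 1))
    linarith

lemma sum_bernoulli_mul_exp_neg_card_le (N : ℕ) [NeZero N] {p : ℝ} (hp : 0 ≤ p) (hp1 : p ≤ 1) :
    ∑ W ∈ (Finset.univ : Finset (ZMod N)).powerset,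
      p ^ W.card * (1 - p) ^ (N - W.card) * Real.exp (-(W.card : ℝ)) ≤
      Real.exp (-(p * N / 2)) := by
  have h := sum_bernoulli_mul_exp_le N hp hp1 (fun _ => -1)
  simp only [Finset.sum_const, nsmul_eq_mul, mul_neg, mul_one, Finset.card_univ, ZMod.card] at h
  refine h.trans (Real.exp_le_exp.mpr ?_)
  have h2 : Real.exp (-1) ≤ 1 / 2 := by
    rw [Real.exp_neg, ← one_div]
    exact one_div_le_one_div_of_le (by norm_num) (by linarith [Real.add_one_le_exp (1 : ℝ)])
  have : 0 ≤ p * N := by positivity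
  nlinarith

lemma sum_bernoulli_mul_exp_inter_le (N : ℕ) [NeZero N] {p α δ : ℝ} (hp : 0 ≤ p) (hp1 : p ≤ 1)
    (hα : 0 ≤ α) (hα1 : α ≤ 1) (hδ : 0 ≤ δ) (hδ1 : δ ≤ 1) {P : Finset (ZMod N)}
    (hP : (P.card : ℝ) ≤ (α - δ) * N) :
    ∑ W ∈ (Finset.univ : Finset (ZMod N)).powerset,
      p ^ W.card * (1 - p) ^ (N - W.card) *
        Real.exp (δ / 2 * ((W ∩ P).card - α * W.card)) ≤
      Real.exp (-(δ ^ 2 / 4 * (p * N))) := by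
  have h := sum_bernoulli_mul_exp_le N hp hp1
    (fun x => δ / 2 * ((if x ∈ P then 1 else 0) - α))
  have hsum : ∀ W : Finset (ZMod N),
      ∑ x ∈ W, δ / 2 * ((if x ∈ P then (1 : ℝ) else 0) - α) =
        δ / 2 * ((W ∩ P).card - α * W.card) := by
    intro W
    rw [← Finset.mul_sum, Finset.sum_sub_distrib, Finset.sum_const, nsmul_eq_mul,
      Finset.sum_boole, Finset.filter_mem_eq_inter, mul_comm α]
  simp only [hsum] at h
  refine h.trans (Real.exp_le_exp.mpr ?_)
  have hterm : ∀ x ∈ (Finset.univ : Finset (ZMod N)),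
      Real.exp (δ / 2 * ((if x ∈ P then 1 else 0) - α)) - 1 ≤
        δ / 2 * ((if x ∈ P then 1 else 0) - α) + δ ^ 2 / 4 := by
    intro x _
    set v : ℝ := (if x ∈ P then 1 else 0) - α with hv
    have hv1 : |v| ≤ 1 := by
      rw [abs_le, hv]
      split_ifs <;> constructor <;> linarith
    have habs : |δ / 2 * v| ≤ δ / 2 := by
      rw [abs_mul, abs_of_nonneg (by positivity : 0 ≤ δ / 2)]
      nlinarith
    have h1 := (abs_le.mp (Real.abs_exp_sub_one_sub_id_le (habs.trans (by linarith)))).2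
    have h2 : (δ / 2 * v) ^ 2 ≤ (δ / 2) ^ 2 := sq_le_sq' (abs_le.mp habs).1 (abs_le.mp habs).2
    nlinarith
  have htot := Finset.sum_le_sum hterm
  rw [Finset.sum_add_distrib, hsum, Finset.univ_inter, Finset.sum_const, nsmul_eq_mul,
    Finset.card_univ, ZMod.card] at htot
  have : ∑ x : ZMod N, (Real.exp (δ / 2 * ((if x ∈ P then 1 else 0) - α)) - 1) ≤
      -(δ ^ 2 / 4 * N) := by nlinarith
  nlinarith [mul_le_mul_of_nonneg_left this hp]

lemma one_sub_le_randomSetProb {N : ℕ} [NeZero N] {p α β δ : ℝ} (hp : 0 ≤ p) (hp1 : p ≤ 1)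
    (hα : 0 < α) (hα1 : α ≤ 1) (hδ : 0 < δ) (hδ1 : δ ≤ 1) (hβ : β + 2 * δ ≤ α) {k : ℕ}
    (hk : 0 < k) (hkδ : (N : ℝ) ≤ δ * k ^ 2) :
    1 - (Real.exp (k / α - p * N / 2) +
        ((k + 1) * (N : ℝ) ^ k) ^ 2 * Real.exp (-(δ ^ 2 / 4 * (p * N)))) ≤
      randomSetProb N p (fun W =>
          ∀ A ⊆ W, α * (W.card : ℝ) ≤ (A.card : ℝ) →
            β * (N : ℝ) ≤ ((A + A).card : ℝ)) := by
  set m : Finset (ZMod N) → ℝ := fun W => p ^ W.card * (1 - p) ^ (N - W.card) with hm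
  have hm0 : ∀ W, 0 ≤ m W := fun W => by
    have : 0 ≤ 1 - p := by linarith
    positivity
  have hm1 : ∑ W ∈ (Finset.univ : Finset (ZMod N)).powerset, m W = 1 := by
    have h := Finset.prod_add (fun _ => p) (fun _ => 1 - p) (Finset.univ : Finset (ZMod N))
    simp only [Finset.prod_const, add_sub_cancel, one_pow] at h
    rw [h]
    refine Finset.sum_congr rfl fun W _ => ?_
    rw [Finset.card_sdiff_of_subset (Finset.subset_univ W), Finset.card_univ, ZMod.card]
  set small := (Finset.univ : Finset (Finset (ZMod N))).filter fun S => S.card ≤ k with hsmall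
  set F := ((small ×ˢ small).image fun ST => (ST.2 - ST.1)ᶜ).filter
    fun P => (P.card : ℝ) ≤ (α - δ) * N with hF
  have hFcard : (F.card : ℝ) ≤ ((k + 1) * (N : ℝ) ^ k) ^ 2 := by
    have h1 : F.card ≤ small.card * small.card :=
      (Finset.card_filter_le _ _).trans (Finset.card_image_le.trans (Finset.card_product _ _).le)
    have h2 := card_filter_card_le (G := ZMod N) Fintype.card_pos k
    rw [ZMod.card] at h2
    have h3 : F.card ≤ ((k + 1) * N ^ k) ^ 2 := by
      rw [sq]
      exact h1.trans (Nat.mul_le_mul h2 h2)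
    exact_mod_cast h3
  set bad : Finset (ZMod N) → ℝ := fun W => Real.exp (k / α) * Real.exp (-(W.card : ℝ)) +
    ∑ P ∈ F, Real.exp (δ / 2 * ((W ∩ P).card - α * W.card)) with hbad
  have hbad0 : ∀ W, 0 ≤ bad W := fun W => by positivity
  have hpoint : ∀ W : Finset (ZMod N), (¬ ∀ A ⊆ W, α * (W.card : ℝ) ≤ (A.card : ℝ) →
      β * (N : ℝ) ≤ ((A + A).card : ℝ)) → 1 ≤ bad W := by
    intro W hW
    push Not at hW
    obtain ⟨A, hAW, hA, hAA⟩ := hW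
    rcases lt_or_ge A.card k with hAk | hAk
    · have h1 : (1 : ℝ) ≤ Real.exp (k / α) * Real.exp (-(W.card : ℝ)) := by
        rw [← Real.exp_add]
        refine Real.one_le_exp ?_
        have : (A.card : ℝ) ≤ k := by exact_mod_cast hAk.le
        have : (W.card : ℝ) ≤ k / α := by
          rw [le_div_iff₀ hα]
          linarith
        linarith
      exact h1.trans (le_add_of_nonneg_right (by positivity))
    · obtain ⟨S, hSA, hS⟩ := Finset.exists_subset_card_eq hAk
      obtain ⟨T, hT, hAT, hcard⟩ := exists_small_container (A := A) (B := (A + A)ᶜ) hδ hk hS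
        (Finset.disjoint_left.mpr fun x hx hx' =>
          Finset.mem_compl.mp hx (Finset.add_subset_add_left hSA hx'))
        (by rwa [ZMod.card])
      rw [ZMod.card] at hcard
      have hcompl : (((A + A)ᶜ.card : ℕ) : ℝ) = N - (A + A).card := by
        have := Finset.card_compl_add_card (A + A)
        rw [ZMod.card] at this
        rw [eq_sub_iff_add_eq]
        exact_mod_cast this
      have hN : (0 : ℝ) ≤ N := Nat.cast_nonneg N
      have hPF : (T - S)ᶜ ∈ F := by
        refine Finset.mem_filter.mpr ⟨Finset.mem_image.mpr ⟨(S, T), ?_, rfl⟩, ?_⟩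
        · simp [hsmall, hS, hT]
        · rw [hcompl] at hcard
          nlinarith
      have hWP : (A.card : ℝ) ≤ (W ∩ (T - S)ᶜ).card := by
        exact_mod_cast Finset.card_le_card (Finset.subset_inter hAW hAT)
      have h1 : 1 ≤ Real.exp (δ / 2 * ((W ∩ (T - S)ᶜ).card - α * W.card)) :=
        Real.one_le_exp (mul_nonneg (by positivity) (by linarith))
      have h2 := Finset.single_le_sum
        (f := fun P => Real.exp (δ / 2 * ((W ∩ P).card - α * W.card)))
        (fun _ _ => (Real.exp_pos _).le) hPF
      exact (h1.trans h2).trans (le_add_of_nonneg_left (by positivity))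
  have hbound : ∑ W ∈ (Finset.univ : Finset (ZMod N)).powerset, m W * bad W ≤
      Real.exp (k / α - p * N / 2) +
        ((k + 1) * (N : ℝ) ^ k) ^ 2 * Real.exp (-(δ ^ 2 / 4 * (p * N))) := by
    simp only [hbad, mul_add, Finset.sum_add_distrib]
    refine add_le_add ?_ ?_
    · have h := sum_bernoulli_mul_exp_neg_card_le N hp hp1
      rw [sub_eq_add_neg, Real.exp_add]
      refine le_trans (le_of_eq ?_) (mul_le_mul_of_nonneg_left h (Real.exp_pos (k / α)).le)
      rw [Finset.mul_sum]
      exact Finset.sum_congr rfl fun W _ => by ring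
    · simp only [Finset.mul_sum]
      rw [Finset.sum_comm]
      refine (Finset.sum_le_card_nsmul _ _ (Real.exp (-(δ ^ 2 / 4 * (p * N)))) ?_).trans ?_
      · exact fun P hP => sum_bernoulli_mul_exp_inter_le N hp hp1 hα.le hα1 hδ.le hδ1
          (Finset.mem_filter.mp hP).2
      · rw [nsmul_eq_mul]
        exact mul_le_mul_of_nonneg_right hFcard (Real.exp_pos _).le
  refine (sub_le_sub_left hbound 1).trans ?_
  rw [← hm1, ← Finset.sum_sub_distrib, randomSetProb]
  refine Finset.sum_le_sum fun W _ => ?_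
  split_ifs with hW
  · exact sub_le_self _ (mul_nonneg (hm0 W) (hbad0 W))
  · nlinarith [hm0 W, hpoint W hW]

lemma tendsto_exp_rpow_sub_rpow (K : ℝ) {c : ℝ} (hc : 0 < c) :
    Filter.Tendsto (fun x : ℝ => Real.exp (K * x ^ (3 / 4 : ℝ) - c * x ^ (7 / 8 : ℝ)))
      Filter.atTop (nhds 0) := by
  refine Real.tendsto_exp_atBot.comp ?_
  have h1 : Filter.Tendsto (fun x : ℝ => x ^ (3 / 4 : ℝ)) Filter.atTop Filter.atTop :=
    tendsto_rpow_atTop (by norm_num)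
  have h2 : Filter.Tendsto (fun x : ℝ => K - c * x ^ (1 / 8 : ℝ)) Filter.atTop Filter.atBot :=
    Filter.tendsto_atBot_add_const_left _ K (Filter.tendsto_neg_atTop_atBot.comp
      ((tendsto_rpow_atTop (by norm_num)).const_mul_atTop hc))
  refine (h1.atTop_mul_atBot₀ h2).congr' ?_
  filter_upwards [Filter.eventually_gt_atTop 0] with x hx
  have : x ^ (7 / 8 : ℝ) = x ^ (3 / 4 : ℝ) * x ^ (1 / 8 : ℝ) := by
    rw [← Real.rpow_add hx]
    norm_num
  rw [this]
  ring

/-- Sumsets of dense subsets of random sets have positive density: with probability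
`1 - o_{α,β}(1)`, every `A ⊆ W` with `|A| ≥ α|W|` satisfies `|A + A| ≥ βN`. -/
theorem sumset_size_in_random_sets (θ C α β : ℝ) (hθ : 0 < θ) (hθ' : θ < 1 / 140)
    (hC : 0 < C) (hβ : 0 < β) (hβα : β < α) (hα : α ≤ 1) :
    ∀ ε : ℝ, 0 < ε → ∃ N₀ : ℕ, ∀ N : ℕ, N₀ ≤ N → N.Prime → ∀ [NeZero N],
      ∀ p : ℝ, C * (N : ℝ) ^ (-θ) < p → p ≤ 1 →
        1 - ε ≤ randomSetProb N p (fun W =>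
          ∀ A ⊆ W, α * (W.card : ℝ) ≤ (A.card : ℝ) →
            β * (N : ℝ) ≤ ((A + A).card : ℝ)) := by
  intro ε hε
  have hα0 : 0 < α := hβ.trans hβα
  set δ : ℝ := (α - β) / 2 with hδdef
  have hδ : 0 < δ := by rw [hδdef]; linarith
  have hδ1 : δ ≤ 1 := by rw [hδdef]; linarith
  set L : ℝ := 1 / √δ + 2 with hL
  have hL0 : 0 < L := by positivity
  set K : ℝ := max (L / α) (16 * L) with hK
  set c : ℝ := δ ^ 2 / 4 * C with hcdef
  have hc : 0 < c := by positivity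
  have htend := (tendsto_exp_rpow_sub_rpow K hc).comp (tendsto_natCast_atTop_atTop (R := ℝ))
  obtain ⟨N₀, hN₀⟩ := Filter.eventually_atTop.mp
    (htend.eventually_lt_const (half_pos hε))
  refine ⟨N₀, fun N hN hprime _ p hp hp1 => ?_⟩
  have hexp : Real.exp (K * (N : ℝ) ^ (3 / 4 : ℝ) - c * (N : ℝ) ^ (7 / 8 : ℝ)) < ε / 2 := hN₀ N hN
  have hN1 : (1 : ℝ) ≤ N := by exact_mod_cast hprime.one_lt.le
  have hN0 : (0 : ℝ) < N := by linarith
  have hp0 : 0 < p := lt_trans (by positivity) hp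
  set k : ℕ := ⌈√N / √δ⌉₊ with hkdef
  have hk : 0 < k := Nat.ceil_pos.mpr (by positivity)
  have hkδ : (N : ℝ) ≤ δ * k ^ 2 := by
    have h1 : √N / √δ ≤ k := Nat.le_ceil _
    have h2 : (√N / √δ) ^ 2 ≤ (k : ℝ) ^ 2 := by gcongr
    rw [div_pow, Real.sq_sqrt hN0.le, Real.sq_sqrt hδ.le, div_le_iff₀ hδ] at h2
    linarith
  have hkL : (k : ℝ) + 1 ≤ L * (N : ℝ) ^ (1 / 2 : ℝ) := by
    have h1 := (Nat.ceil_lt_add_one (by positivity : 0 ≤ √(N : ℝ) / √δ)).le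
    have h2 : 1 ≤ √(N : ℝ) := Real.one_le_sqrt.mpr hN1
    rw [← Real.sqrt_eq_rpow, hL, add_mul, one_div_mul_eq_div]
    linarith
  have hpN : C * (N : ℝ) ^ (7 / 8 : ℝ) ≤ p * N := by
    have h1 : (N : ℝ) ^ (-(1 / 8) : ℝ) ≤ (N : ℝ) ^ (-θ) :=
      Real.rpow_le_rpow_of_exponent_le hN1 (by linarith)
    have h2 : (N : ℝ) ^ (7 / 8 : ℝ) = (N : ℝ) ^ (-(1 / 8) : ℝ) * N := by
      rw [← Real.rpow_add_one hN0.ne']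
      norm_num
    rw [h2, ← mul_assoc]
    gcongr
    exact (mul_le_mul_of_nonneg_left h1 hC.le).trans hp.le
  have hhalf : (N : ℝ) ^ (1 / 2 : ℝ) ≤ (N : ℝ) ^ (3 / 4 : ℝ) :=
    Real.rpow_le_rpow_of_exponent_le hN1 (by norm_num)
  have hdecay : c * (N : ℝ) ^ (7 / 8 : ℝ) ≤ δ ^ 2 / 4 * (p * N) := by
    rw [hcdef, mul_assoc]
    gcongr
  have hfirst : Real.exp (k / α - p * N / 2) ≤ ε / 2 := by
    refine le_trans (Real.exp_le_exp.mpr (sub_le_sub ?_ ?_)) hexp.le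
    · calc (k : ℝ) / α ≤ L * (N : ℝ) ^ (1 / 2 : ℝ) / α := by gcongr; linarith
        _ = L / α * (N : ℝ) ^ (1 / 2 : ℝ) := by ring
        _ ≤ K * (N : ℝ) ^ (3 / 4 : ℝ) := by
          gcongr
          exact le_max_left _ _
    · have h1 : 0 ≤ p * N := by positivity
      have h2 : δ ^ 2 ≤ 1 := pow_le_one₀ hδ.le hδ1
      linarith [mul_le_mul_of_nonneg_right h2 h1]
  have hsecond : ((k + 1) * (N : ℝ) ^ k) ^ 2 * Real.exp (-(δ ^ 2 / 4 * (p * N))) ≤ ε / 2 := by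
    have hlog : Real.log N ≤ 4 * (N : ℝ) ^ (1 / 4 : ℝ) := by
      have := Real.log_le_rpow_div hN0.le (by norm_num : (0 : ℝ) < 1 / 4)
      linarith
    have hlog0 : 0 ≤ Real.log N := Real.log_nonneg hN1
    have h34 : (N : ℝ) ^ (3 / 4 : ℝ) = (N : ℝ) ^ (1 / 2 : ℝ) * (N : ℝ) ^ (1 / 4 : ℝ) := by
      rw [← Real.rpow_add hN0]
      norm_num
    have hr1 : (1 : ℝ) ≤ (N : ℝ) ^ (1 / 4 : ℝ) := Real.one_le_rpow hN1 (by norm_num)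
    have hpow : (k + 1) * (N : ℝ) ^ k ≤ Real.exp (K / 2 * (N : ℝ) ^ (3 / 4 : ℝ)) := by
      have h1 : (k : ℝ) + 1 ≤ Real.exp (k + 1) := by linarith [Real.add_one_le_exp ((k : ℝ) + 1)]
      have h2 : (N : ℝ) ^ k = Real.exp (k * Real.log N) := by
        rw [Real.exp_nat_mul, Real.exp_log hN0]
      rw [h2]
      refine (mul_le_mul_of_nonneg_right h1 (Real.exp_pos _).le).trans ?_
      rw [← Real.exp_add]
      refine Real.exp_le_exp.mpr ?_
      have hk0 : (0 : ℝ) ≤ k := Nat.cast_nonneg k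
      calc (k : ℝ) + 1 + k * Real.log N
          ≤ (k + 1) * (5 * (N : ℝ) ^ (1 / 4 : ℝ)) := by nlinarith
        _ ≤ L * (N : ℝ) ^ (1 / 2 : ℝ) * (5 * (N : ℝ) ^ (1 / 4 : ℝ)) := by gcongr
        _ = 5 * L * (N : ℝ) ^ (3 / 4 : ℝ) := by rw [h34]; ring
        _ ≤ K / 2 * (N : ℝ) ^ (3 / 4 : ℝ) := by
          gcongr
          linarith [le_max_right (L / α) (16 * L)]
    calc ((k + 1) * (N : ℝ) ^ k) ^ 2 * Real.exp (-(δ ^ 2 / 4 * (p * N)))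
        ≤ Real.exp (K / 2 * (N : ℝ) ^ (3 / 4 : ℝ)) ^ 2 *
            Real.exp (-(c * (N : ℝ) ^ (7 / 8 : ℝ))) := by gcongr
      _ = Real.exp (K * (N : ℝ) ^ (3 / 4 : ℝ) - c * (N : ℝ) ^ (7 / 8 : ℝ)) := by
        rw [← Real.exp_nat_mul, ← Real.exp_add]
        congr 1
        push_cast
        ring
      _ ≤ ε / 2 := hexp.le
  have hmain := one_sub_le_randomSetProb (N := N) (β := β) hp0.le hp1 hα0 hα hδ hδ1
    (by rw [hδdef]; linarith) hk hkδ
  linarith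
end

section
/- Let 0 < θ < 1/140 and C > 0. There exist absolute constants C₁, C₂ > 0 such that the following holds. Fix α ∈ (0,1] and an integer k ≥ 3, and for each prime N let W be a random subset of Z_N with parameter p = p(N) ∈ (CN^{-θ}, 1]. Then for every ε > 0 there is N₀ such that for all primes N ≥ N₀ for which α ≥ C₁ (log log N)/√(log N) and k ≤ exp( α² log log N / ( C₂ log(1/α) ( log log log N + log(1/α) ) ) ), the probability that the following holds is at least 1 − ε: for every set A ⊆ W with |A| ≥ α|W|, the sumset A + A contains a nontrivial arithmetic progression of length k. -/
open scoped Classical BigOperators Pointwise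

open Finset

/-- The number of representations of `x` as `a + b` with `a, b ∈ A`. -/
noncomputable def repCount {N : ℕ} (A : Finset (ZMod N)) (x : ZMod N) : ℝ :=
  ∑ a ∈ A, ∑ b ∈ A, if a + b = x then 1 else 0

lemma mem_add_of_repCount_ne_zero {N : ℕ} {A : Finset (ZMod N)} {x : ZMod N} (h : repCount A x ≠ 0) :
    x ∈ A + A := by
  by_contra hx
  refine h (Finset.sum_eq_zero fun a ha => Finset.sum_eq_zero fun b hb => if_neg fun hab => hx ?_)
  exact hab ▸ Finset.add_mem_add ha hb

section Fourier

variable {N : ℕ} [NeZero N]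

/-- The exponential sum of a finite set `A ⊆ ZMod N` at the frequency `t`. -/
noncomputable def expSum (A : Finset (ZMod N)) (t : ZMod N) : ℂ :=
  ∑ x ∈ A, ZMod.stdAddChar (t * x)

lemma expSum_univ (t : ZMod N) :
    expSum (univ : Finset (ZMod N)) t = if t = 0 then (N : ℂ) else 0 := by
  have h := AddChar.sum_mulShift t (ZMod.isPrimitive_stdAddChar N)
  rw [ZMod.card] at h
  simp only [expSum, mul_comm t]
  rw [h]
  split_ifs <;> simp

lemma norm_expSum_le (A : Finset (ZMod N)) (t : ZMod N) : ‖expSum A t‖ ≤ A.card := by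
  refine (norm_sum_le _ _).trans ?_
  simp [AddChar.norm_apply]

lemma sum_norm_sq_trigPoly (W R : Finset (ZMod N)) (c : ZMod N → ℂ) :
    ((∑ x ∈ W, ‖∑ t ∈ R, c t * ZMod.stdAddChar (t * x)‖ ^ 2 : ℝ) : ℂ) =
      ∑ t ∈ R, ∑ s ∈ R, c t * (starRingEnd ℂ) (c s) * expSum W (t - s) := by
  push_cast
  simp_rw [← Complex.mul_conj', map_sum, map_mul, Finset.sum_mul_sum, expSum, Finset.mul_sum]
  rw [Finset.sum_comm]
  refine Finset.sum_congr rfl fun t _ => ?_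
  rw [Finset.sum_comm]
  refine Finset.sum_congr rfl fun s _ => Finset.sum_congr rfl fun x _ => ?_
  rw [sub_mul, sub_eq_add_neg, AddChar.map_add_eq_mul, AddChar.map_neg_eq_conj]
  ring

lemma parseval (h : ZMod N → ℂ) :
    ∑ t, ‖∑ x, h x * ZMod.stdAddChar (t * x)‖ ^ 2 = N * ∑ x, ‖h x‖ ^ 2 := by
  have key := sum_norm_sq_trigPoly (univ : Finset (ZMod N)) univ h
  simp_rw [expSum_univ, sub_eq_zero] at key
  simp only [mul_ite, mul_zero, Finset.sum_ite_eq, Finset.mem_univ, if_true,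
    Complex.mul_conj'] at key
  have h2 : ∑ t, ‖∑ x, h x * ZMod.stdAddChar (x * t)‖ ^ 2 = (∑ x, ‖h x‖ ^ 2) * N := by
    rw [Finset.sum_mul]
    exact_mod_cast key
  rw [mul_comm, ← h2]
  simp_rw [mul_comm]

lemma sum_norm_expSum_sq (A : Finset (ZMod N)) : ∑ t, ‖expSum A t‖ ^ 2 = N * A.card := by
  have h := parseval (N := N) (fun x => if x ∈ A then 1 else 0)
  simp only [ite_mul, one_mul, zero_mul, Finset.sum_ite_mem, Finset.univ_inter] at h
  simp only [expSum, h]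
  congr 1
  simp [apply_ite]

lemma sum_repCount (A : Finset (ZMod N)) : ∑ x, repCount A x = (A.card : ℝ) ^ 2 := by
  simp only [repCount]
  rw [Finset.sum_comm]
  simp_rw [Finset.sum_comm (s := univ)]
  simp [sq]

lemma sum_repCount_sub_mul (A : Finset (ZMod N)) (u t : ZMod N) :
    ∑ x, (repCount A (x - u) : ℂ) * ZMod.stdAddChar (t * x) =
      ZMod.stdAddChar (t * u) * expSum A t ^ 2 := by
  simp only [repCount, Complex.ofReal_sum, Finset.sum_mul]
  rw [Finset.sum_comm]
  simp_rw [Finset.sum_comm (s := univ)]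
  rw [sq, expSum, Finset.sum_mul_sum, Finset.mul_sum]
  refine Finset.sum_congr rfl fun a _ => ?_
  rw [Finset.mul_sum]
  refine Finset.sum_congr rfl fun b _ => ?_
  simp_rw [eq_sub_iff_add_eq]
  simp only [apply_ite, Complex.ofReal_one, Complex.ofReal_zero, ite_mul, one_mul, zero_mul,
    Finset.sum_ite_eq, Finset.mem_univ, if_true, mul_add, AddChar.map_add_eq_mul]
  ring

lemma sum_repCount_shift_sq (A : Finset (ZMod N)) (u : ZMod N) :
    N * ∑ x, (repCount A (x - u) - repCount A x) ^ 2 =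
      ∑ t, ‖expSum A t‖ ^ 4 * ‖ZMod.stdAddChar (t * u) - 1‖ ^ 2 := by
  have h := parseval (N := N) (fun x => (repCount A (x - u) : ℂ) - (repCount A x : ℂ))
  have h0 : ∀ t, ∑ x, (repCount A x : ℂ) * ZMod.stdAddChar (t * x) = expSum A t ^ 2 := by
    intro t
    simpa using sum_repCount_sub_mul A 0 t
  simp_rw [sub_mul, Finset.sum_sub_distrib, sum_repCount_sub_mul, h0] at h
  have h1 : ∀ x, ‖(repCount A (x - u) : ℂ) - (repCount A x : ℂ)‖ ^ 2 =
      (repCount A (x - u) - repCount A x) ^ 2 := by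
    intro x
    rw [← Complex.ofReal_sub, Complex.norm_real, Real.norm_eq_abs, sq_abs]
  simp_rw [h1] at h
  rw [← h]
  refine Finset.sum_congr rfl fun t _ => ?_
  rw [← sub_one_mul, norm_mul, norm_pow]
  ring

/-- A large-spectrum restriction estimate for subsets of a pseudorandom set. -/
lemma sum_norm_expSum_sq_le_of_subset {A W R : Finset (ZMod N)} (hAW : A ⊆ W) {η : ℝ}
    (hη : ∀ t : ZMod N, t ≠ 0 → ‖expSum W t‖ ≤ η) (hη0 : 0 ≤ η) :
    ∑ t ∈ R, ‖expSum A t‖ ^ 2 ≤ W.card * (W.card + η * R.card) := by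
  set S := ∑ t ∈ R, ‖expSum A t‖ ^ 2 with hS
  have hS0 : 0 ≤ S := Finset.sum_nonneg fun _ _ => by positivity
  set H : ZMod N → ℂ := fun x => ∑ t ∈ R, (starRingEnd ℂ) (expSum A t) * ZMod.stdAddChar (t * x)
    with hH
  have h1 : (S : ℂ) = ∑ x ∈ A, H x := by
    simp only [hH, hS]
    push_cast
    rw [Finset.sum_comm]
    refine Finset.sum_congr rfl fun t _ => ?_
    rw [← Finset.mul_sum, ← Complex.conj_mul']
    rfl
  have h2 : S ≤ ∑ x ∈ A, ‖H x‖ := by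
    calc S = ‖(S : ℂ)‖ := by rw [Complex.norm_real, Real.norm_of_nonneg hS0]
      _ ≤ _ := by rw [h1]; exact norm_sum_le _ _
  have h3 : S ^ 2 ≤ W.card * ∑ x ∈ W, ‖H x‖ ^ 2 := by
    calc S ^ 2 ≤ (∑ x ∈ A, ‖H x‖) ^ 2 := by gcongr
      _ ≤ A.card * ∑ x ∈ A, ‖H x‖ ^ 2 := sq_sum_le_card_mul_sum_sq
      _ ≤ _ := by
        gcongr
  have h4 : ∑ x ∈ W, ‖H x‖ ^ 2 ≤ (W.card + η * R.card) * S := by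
    have hq := sum_norm_sq_trigPoly W R (fun t => (starRingEnd ℂ) (expSum A t))
    have hbd : ∀ t s : ZMod N, ‖expSum W (t - s)‖ ≤ (if t = s then (W.card : ℝ) else 0) + η := by
      intro t s
      split_ifs with h
      · exact (norm_expSum_le W _).trans (by linarith)
      · simpa using hη _ (sub_ne_zero.mpr h)
    calc ∑ x ∈ W, ‖H x‖ ^ 2 = ‖((∑ x ∈ W, ‖H x‖ ^ 2 : ℝ) : ℂ)‖ := by
          rw [Complex.norm_real, Real.norm_of_nonneg (Finset.sum_nonneg fun _ _ => by positivity)]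
      _ ≤ ∑ t ∈ R, ∑ s ∈ R, ‖expSum A t‖ * ‖expSum A s‖ *
            ((if t = s then (W.card : ℝ) else 0) + η) := by
          rw [hq]
          refine (norm_sum_le _ _).trans (Finset.sum_le_sum fun t _ => ?_)
          refine (norm_sum_le _ _).trans (Finset.sum_le_sum fun s _ => ?_)
          rw [norm_mul, norm_mul, RCLike.norm_conj, RCLike.norm_conj, RCLike.norm_conj]
          gcongr
          exact hbd t s
      _ = W.card * S + η * (∑ t ∈ R, ‖expSum A t‖) ^ 2 := by
          simp only [mul_add, Finset.sum_add_distrib, mul_ite, mul_zero, Finset.sum_ite_eq]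
          rw [sq, Finset.sum_mul_sum, hS, Finset.mul_sum, Finset.mul_sum]
          congr 1
          · refine Finset.sum_congr rfl fun t ht => ?_
            rw [if_pos ht]; ring
          · refine Finset.sum_congr rfl fun t ht => ?_
            rw [Finset.mul_sum]
            exact Finset.sum_congr rfl fun s _ => by ring
      _ ≤ W.card * S + η * (R.card * S) := by
          gcongr
          exact sq_sum_le_card_mul_sum_sq
      _ = _ := by ring
  rcases hS0.eq_or_lt with h0 | hpos
  · rw [← h0]; positivity
  · have h5 : S * S ≤ W.card * (W.card + η * R.card) * S := by
      nlinarith [mul_le_mul_of_nonneg_left h4 (Nat.cast_nonneg (α := ℝ) W.card)]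
    exact le_of_mul_le_mul_right h5 hpos

lemma sum_repCount_shift_sq_le {A : Finset (ZMod N)} {u : ZMod N} {P δ τ : ℝ}
    (hA : A.card ≤ 2 * P) (hτ0 : 0 ≤ τ) (hτ : τ ≤ δ ^ 2 * P ^ 2)
    (hsmall : ∀ t, δ ^ 2 * P ^ 2 ≤ ‖expSum A t‖ ^ 2 →
      ‖(ZMod.stdAddChar (t * u) : ℂ) - 1‖ ≤ δ) :
    N * ∑ x, (repCount A (x - u) - repCount A x) ^ 2 ≤
      8 * δ ^ 2 * P ^ 2 * ∑ t with τ ≤ ‖expSum A t‖ ^ 2, ‖expSum A t‖ ^ 2 +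
        4 * τ * (N * A.card) := by
  have hdisp : ∀ t, ‖expSum A t‖ ^ 4 * ‖(ZMod.stdAddChar (t * u) : ℂ) - 1‖ ^ 2 ≤
      (if τ ≤ ‖expSum A t‖ ^ 2 then 8 * δ ^ 2 * P ^ 2 * ‖expSum A t‖ ^ 2 else 0) +
        4 * τ * ‖expSum A t‖ ^ 2 := by
    intro t
    have hz : 0 ≤ 4 * τ * ‖expSum A t‖ ^ 2 := by positivity
    have hq : 0 ≤ δ ^ 2 * P ^ 2 * ‖expSum A t‖ ^ 2 := by positivity
    have h2 : ‖(ZMod.stdAddChar (t * u) : ℂ) - 1‖ ≤ 2 := by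
      refine (norm_sub_le _ _).trans ?_
      rw [AddChar.norm_apply, norm_one]
      norm_num
    have ht4 : ‖(ZMod.stdAddChar (t * u) : ℂ) - 1‖ ^ 2 ≤ 4 :=
      (pow_le_pow_left₀ (norm_nonneg _) h2 2).trans_eq (by norm_num)
    have hAt : ‖expSum A t‖ ^ 2 ≤ (2 * P) ^ 2 :=
      pow_le_pow_left₀ (norm_nonneg _) ((norm_expSum_le A t).trans hA) 2
    have hst := hsmall t
    rw [show ‖expSum A t‖ ^ 4 = ‖expSum A t‖ ^ 2 * ‖expSum A t‖ ^ 2 by ring]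
    have hy := sq_nonneg ‖expSum A t‖
    have hv := sq_nonneg ‖(ZMod.stdAddChar (t * u) : ℂ) - 1‖
    by_cases h1 : δ ^ 2 * P ^ 2 ≤ ‖expSum A t‖ ^ 2
    · rw [if_pos (hτ.trans h1)]
      have h3 : ‖(ZMod.stdAddChar (t * u) : ℂ) - 1‖ ^ 2 ≤ δ ^ 2 :=
        pow_le_pow_left₀ (norm_nonneg _) (hst h1) 2
      calc _ ≤ (2 * P) ^ 2 * ‖expSum A t‖ ^ 2 * δ ^ 2 := by gcongr
        _ ≤ _ := by linarith
    by_cases h2 : τ ≤ ‖expSum A t‖ ^ 2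
    · rw [if_pos h2]
      calc _ ≤ δ ^ 2 * P ^ 2 * ‖expSum A t‖ ^ 2 * 4 := by
            gcongr
            exact (not_le.mp h1).le
        _ ≤ _ := by linarith
    · rw [if_neg h2]
      calc _ ≤ τ * ‖expSum A t‖ ^ 2 * 4 := by
            gcongr
            exact (not_le.mp h2).le
        _ = _ := by ring
  rw [sum_repCount_shift_sq]
  refine (Finset.sum_le_sum fun t _ => hdisp t).trans_eq ?_
  rw [Finset.sum_add_distrib, ← Finset.sum_filter, ← Finset.mul_sum, ← Finset.mul_sum,
    sum_norm_expSum_sq]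

/-- If all shifts of the representation function of `A + A` along a progression are close to it in
mean square, then `A + A` contains a progression with the same common difference. -/
lemma exists_progression_of_shift_le {A : Finset (ZMod N)} {d : ZMod N} {k : ℕ} {E : ℝ}
    (hshift : ∀ i : ℕ, i < k →
      N * ∑ x, (repCount A (x - (i : ZMod N) * d) - repCount A x) ^ 2 ≤ E)
    (hE : k ^ 2 * E < (A.card : ℝ) ^ 4) :
    ∃ a : ZMod N, ∀ i : ℕ, i < k → a + (i : ZMod N) * (-d) ∈ A + A := by
  by_contra! hno
  have hvanish : ∀ x : ZMod N, ∃ i : ℕ, i < k ∧ repCount A (x - (i : ZMod N) * d) = 0 := by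
    intro x
    obtain ⟨i, hi, h⟩ := hno x
    refine ⟨i, hi, ?_⟩
    by_contra h'
    exact h (by simpa [sub_eq_add_neg] using mem_add_of_repCount_ne_zero h')
  have hsum : (A.card : ℝ) ^ 2 ≤
      ∑ i ∈ range k, ∑ x, |repCount A (x - (i : ZMod N) * d) - repCount A x| := by
    rw [← sum_repCount, Finset.sum_comm]
    refine Finset.sum_le_sum fun x _ => ?_
    obtain ⟨i, hi, h⟩ := hvanish x
    refine le_trans ?_ (Finset.single_le_sum
      (f := fun i : ℕ => |repCount A (x - (i : ZMod N) * d) - repCount A x|)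
      (fun _ _ => abs_nonneg _) (Finset.mem_range.mpr hi))
    simp only [h, zero_sub, abs_neg]
    exact le_abs_self _
  have hsq : ((A.card : ℝ) ^ 2) ^ 2 ≤
      k ^ 2 * E := by
    calc ((A.card : ℝ) ^ 2) ^ 2
        ≤ (∑ i ∈ range k, ∑ x, |repCount A (x - (i : ZMod N) * d) - repCount A x|) ^ 2 := by gcongr
      _ ≤ k * ∑ i ∈ range k, (∑ x, |repCount A (x - (i : ZMod N) * d) - repCount A x|) ^ 2 := by
          have := sq_sum_le_card_mul_sum_sq (s := range k)
            (f := fun i : ℕ => ∑ x, |repCount A (x - (i : ZMod N) * d) - repCount A x|)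
          rwa [Finset.card_range] at this
      _ ≤ k * ∑ _i ∈ range k, E := by
          gcongr with i hi
          refine le_trans ?_ (hshift i (Finset.mem_range.mp hi))
          have := sq_sum_le_card_mul_sum_sq (s := (univ : Finset (ZMod N)))
            (f := fun x => |repCount A (x - (i : ZMod N) * d) - repCount A x|)
          simpa only [Finset.card_univ, ZMod.card, sq_abs] using this
      _ = _ := by
          rw [Finset.sum_const, Finset.card_range, nsmul_eq_mul]
          ring
  exact hE.not_ge (by rwa [← pow_mul] at hsq)

lemma norm_stdAddChar_sub_one_le {a b : ZMod N} {Q : ℕ} (hQ : 0 < Q)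
    (h : a.val * Q / N = b.val * Q / N) :
    ‖(ZMod.stdAddChar (a - b) : ℂ) - 1‖ ≤ 2 * Real.pi / Q := by
  have hN : 0 < N := Nat.pos_of_neZero N
  have hcast : a - b = (((a.val : ℤ) - b.val : ℤ) : ZMod N) := by simp
  have hN' : (0 : ℝ) < N := by exact_mod_cast hN
  have hQ' : (0 : ℝ) < Q := by exact_mod_cast hQ
  have e : (2 * (Real.pi : ℂ) * Complex.I * (((a.val : ℤ) - b.val : ℤ) : ℂ) / (N : ℂ)) =
      Complex.I * ((2 * Real.pi * ((a.val : ℝ) - b.val) / N : ℝ) : ℂ) := by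
    push_cast
    ring
  rw [hcast, ZMod.stdAddChar_coe, e]
  refine Real.norm_exp_I_mul_ofReal_sub_one_le.trans ?_
  have ha1 := Nat.div_mul_le_self (a.val * Q) N
  have ha2 := Nat.lt_div_mul_add (a := a.val * Q) hN
  have hb1 := Nat.div_mul_le_self (b.val * Q) N
  have hb2 := Nat.lt_div_mul_add (a := b.val * Q) hN
  rw [← h] at hb1 hb2
  have h1 : ((a.val * Q : ℕ) : ℝ) ≤ ((b.val * Q + N : ℕ) : ℝ) := by
    exact_mod_cast (by omega : a.val * Q ≤ b.val * Q + N)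
  have h2 : ((b.val * Q : ℕ) : ℝ) ≤ ((a.val * Q + N : ℕ) : ℝ) := by
    exact_mod_cast (by omega : b.val * Q ≤ a.val * Q + N)
  push_cast at h1 h2
  have h3 : |((a.val : ℝ) - b.val)| ≤ N / Q := by
    rw [abs_le, ← neg_div, div_le_iff₀ hQ', le_div_iff₀ hQ']
    constructor <;> linarith
  rw [Real.norm_eq_abs, abs_div, abs_mul, abs_of_pos Real.two_pi_pos, abs_of_pos hN']
  rw [div_le_div_iff₀ hN' hQ']
  rw [le_div_iff₀ hQ'] at h3
  nlinarith [Real.two_pi_pos]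

lemma exists_bohr_ne_zero (R : Finset (ZMod N)) {Q : ℕ} (hQ : 0 < Q) (hN : Q ^ R.card < N) :
    ∃ d : ZMod N, d ≠ 0 ∧ ∀ t ∈ R, ‖(ZMod.stdAddChar (t * d) : ℂ) - 1‖ ≤ 2 * Real.pi / Q := by
  have hlt : ∀ a : ZMod N, a.val * Q / N < Q := fun a =>
    Nat.div_lt_of_lt_mul (Nat.mul_lt_mul_of_pos_right (ZMod.val_lt a) hQ)
  obtain ⟨x, y, hxy, h⟩ := Fintype.exists_ne_map_eq_of_card_lt
    (fun (d : ZMod N) (t : R) => (⟨(t.1 * d).val * Q / N, hlt _⟩ : Fin Q))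
    (by simpa [ZMod.card] using hN)
  refine ⟨x - y, sub_ne_zero.mpr hxy, fun t ht => ?_⟩
  rw [mul_sub]
  exact norm_stdAddChar_sub_one_le hQ (congrArg Fin.val (congrFun h ⟨t, ht⟩))

lemma norm_pow_sub_one_le_nat_mul {z : ℂ} (hz : ‖z‖ = 1) (n : ℕ) :
    ‖z ^ n - 1‖ ≤ n * ‖z - 1‖ := by
  induction n with
  | zero => simp
  | succ n ih =>
    have e : z ^ (n + 1) - 1 = z ^ n * (z - 1) + (z ^ n - 1) := by ring
    rw [e]
    refine (norm_add_le _ _).trans ?_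
    rw [norm_mul, norm_pow, hz, one_pow]
    push_cast
    linarith

end Fourier

/-- Dense subsets of a pseudorandom set have sumsets containing arithmetic progressions of any
fixed length. -/
theorem exists_progression_of_pseudorandom {α : ℝ} (hα : 0 < α) {k : ℕ} (hk : 0 < k) :
    ∃ N₀ : ℕ, ∀ N : ℕ, N₀ ≤ N → ∀ [NeZero N], ∀ P η : ℝ, 0 < P → P ≤ N → 0 ≤ η →
      3200 * k ^ 2 / α ^ 4 * (η * N ^ 2) ≤ P ^ 3 → ∀ W : Finset (ZMod N),
      |(W.card : ℝ) - P| ≤ P / 2 → (∀ t : ZMod N, t ≠ 0 → ‖expSum W t‖ ≤ η) →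
      ∀ A ⊆ W, α * W.card ≤ A.card →
        ∃ a d : ZMod N, d ≠ 0 ∧ ∀ i : ℕ, i < k → a + (i : ZMod N) * d ∈ A + A := by
  have hk' : (0 : ℝ) < k := by exact_mod_cast hk
  set δ : ℝ := α ^ 2 / (40 * k) with hδ
  have hδ0 : 0 < δ := by positivity
  set Q : ℕ := ⌈2 * Real.pi * k / δ⌉₊ with hQ
  have hQ0 : 0 < Q := Nat.ceil_pos.mpr (by positivity)
  have hQ0' : (0 : ℝ) < Q := by exact_mod_cast hQ0
  refine ⟨Q ^ ⌈6 / δ ^ 2⌉₊ + 1, fun N hN _ P η hP hPN hη0 hK W hW hη A hAW hA => ?_⟩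
  have hN0 : (0 : ℝ) < N := hP.trans_le hPN
  rw [abs_le] at hW
  have hW2 : (W.card : ℝ) ≤ 2 * P := by linarith
  have hA2 : (A.card : ℝ) ≤ 2 * P :=
    (Nat.cast_le.mpr (Finset.card_le_card hAW)).trans hW2
  have hA1 : α * P / 2 ≤ A.card := by nlinarith
  have hδk : δ ^ 2 * k ^ 2 = α ^ 4 / 1600 := by rw [hδ]; field_simp; norm_num
  have hKδ : (3200 * k ^ 2 / α ^ 4 : ℝ) = 2 / δ ^ 2 := by rw [hδ]; field_simp; norm_num
  rw [hKδ, div_mul_eq_mul_div, div_le_iff₀ (by positivity)] at hK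
  set R := univ.filter fun t : ZMod N => δ ^ 2 * P ^ 2 ≤ ‖expSum A t‖ ^ 2 with hR
  set R' := univ.filter fun t : ZMod N => 2 * η * N ≤ ‖expSum A t‖ ^ 2 with hR'
  have hthr : 2 * η * N ≤ δ ^ 2 * P ^ 2 := by
    have h1 : 2 * η * N * N ≤ δ ^ 2 * P ^ 2 * N := by
      nlinarith [mul_le_mul_of_nonneg_left hPN (by positivity : 0 ≤ δ ^ 2 * P ^ 2)]
    exact le_of_mul_le_mul_right h1 hN0
  have hRR' : R ⊆ R' := by
    intro t ht
    rw [hR, Finset.mem_filter] at ht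
    rw [hR', Finset.mem_filter]
    exact ⟨ht.1, hthr.trans ht.2⟩
  have htot : ∑ t, ‖expSum A t‖ ^ 2 ≤ N * (2 * P) := by
    rw [sum_norm_expSum_sq]; gcongr
  have hcard' : η * R'.card ≤ P := by
    have h1 : (R'.card : ℝ) * (2 * η * N) ≤ N * (2 * P) := by
      calc (R'.card : ℝ) * (2 * η * N) = ∑ _t ∈ R', 2 * η * N := by simp
        _ ≤ ∑ t ∈ R', ‖expSum A t‖ ^ 2 :=
          Finset.sum_le_sum fun t ht => (Finset.mem_filter.mp ht).2
        _ ≤ ∑ t, ‖expSum A t‖ ^ 2 :=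
          Finset.sum_le_sum_of_subset_of_nonneg (Finset.subset_univ _)
            fun _ _ _ => by positivity
        _ ≤ _ := htot
    have h2 : η * R'.card * (2 * N) ≤ P * (2 * N) := by linarith
    exact le_of_mul_le_mul_right h2 (by positivity)
  have hS : ∑ t ∈ R', ‖expSum A t‖ ^ 2 ≤ 6 * P ^ 2 := by
    calc _ ≤ W.card * (W.card + η * R'.card) := sum_norm_expSum_sq_le_of_subset hAW hη hη0
      _ ≤ (2 * P) * (2 * P + P) := by gcongr
      _ = _ := by ring
  have hcard : R.card ≤ ⌈6 / δ ^ 2⌉₊ := by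
    have h1 : (R.card : ℝ) * (δ ^ 2 * P ^ 2) ≤ 6 * P ^ 2 := by
      calc (R.card : ℝ) * (δ ^ 2 * P ^ 2) = ∑ _t ∈ R, δ ^ 2 * P ^ 2 := by simp
        _ ≤ ∑ t ∈ R, ‖expSum A t‖ ^ 2 :=
          Finset.sum_le_sum fun t ht => (Finset.mem_filter.mp ht).2
        _ ≤ ∑ t ∈ R', ‖expSum A t‖ ^ 2 :=
          Finset.sum_le_sum_of_subset_of_nonneg hRR' fun _ _ _ => by positivity
        _ ≤ _ := hS
    have h2 : (R.card : ℝ) ≤ 6 / δ ^ 2 := by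
      rw [le_div_iff₀ (by positivity)]
      have h3 : (R.card : ℝ) * δ ^ 2 * P ^ 2 ≤ 6 * P ^ 2 := by linarith
      exact le_of_mul_le_mul_right h3 (by positivity)
    exact_mod_cast h2.trans (Nat.le_ceil _)
  obtain ⟨d, hd0, hd⟩ := exists_bohr_ne_zero R hQ0
    ((Nat.pow_le_pow_right hQ0 hcard).trans_lt (Nat.lt_of_succ_le hN))
  have hshift : ∀ i : ℕ, i < k → N * ∑ x, (repCount A (x - (i : ZMod N) * d) - repCount A x) ^ 2 ≤
      48 * δ ^ 2 * P ^ 4 + 16 * (η * N ^ 2) * P := by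
    intro i hi
    have hsmall : ∀ t ∈ R, ‖(ZMod.stdAddChar (t * ((i : ZMod N) * d)) : ℂ) - 1‖ ≤ δ := by
      intro t ht
      have e : t * ((i : ZMod N) * d) = i • (t * d) := by rw [nsmul_eq_mul]; ring
      rw [e, AddChar.map_nsmul_eq_pow]
      refine (norm_pow_sub_one_le_nat_mul (AddChar.norm_apply _ _) i).trans ?_
      calc (i : ℝ) * ‖(ZMod.stdAddChar (t * d) : ℂ) - 1‖ ≤ k * (2 * Real.pi / Q) := by
            gcongr
            exact hd t ht
        _ ≤ δ := by
            have hc : 2 * Real.pi * k / δ ≤ Q := Nat.le_ceil _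
            rw [div_le_iff₀ hδ0] at hc
            rw [← mul_div_assoc, div_le_iff₀ hQ0']
            linarith
    refine (sum_repCount_shift_sq_le hA2 (by positivity) hthr
      fun t ht => hsmall t (Finset.mem_filter.mpr ⟨Finset.mem_univ _, ht⟩)).trans ?_
    calc _ ≤ 8 * δ ^ 2 * P ^ 2 * (6 * P ^ 2) + 4 * (2 * η * N) * (N * (2 * P)) := by gcongr
      _ = _ := by ring
  have hlow : (α * P / 2) ^ 4 ≤ (A.card : ℝ) ^ 4 := by gcongr
  have hup : k ^ 2 * (48 * δ ^ 2 * P ^ 4 + 16 * (η * N ^ 2) * P) ≤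
      k ^ 2 * (56 * δ ^ 2 * P ^ 4) := by
    gcongr
    linarith [mul_le_mul_of_nonneg_right hK hP.le]
  have hfin : (k : ℝ) ^ 2 * (56 * δ ^ 2 * P ^ 4) = 56 / 1600 * (α ^ 4 * P ^ 4) := by
    linear_combination 56 * P ^ 4 * hδk
  have hpos : 0 < α ^ 4 * P ^ 4 := by positivity
  obtain ⟨a, ha⟩ := exists_progression_of_shift_le hshift (by linarith)
  exact ⟨a, -d, neg_ne_zero.mpr hd0, ha⟩

lemma bernoulliWeight_nonneg {N : ℕ} {p : ℝ} (hp0 : 0 ≤ p) (hp1 : p ≤ 1) (W : Finset (ZMod N)) :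
    0 ≤ p ^ W.card * (1 - p) ^ (N - W.card) :=
  mul_nonneg (pow_nonneg hp0 _) (pow_nonneg (sub_nonneg.mpr hp1) _)

section RandomSet

variable {N : ℕ} [NeZero N]

lemma sum_bernoulliWeight_mul_prod (p : ℝ) (u : ZMod N → ℝ) :
    ∑ W ∈ (univ : Finset (ZMod N)).powerset,
      p ^ W.card * (1 - p) ^ (N - W.card) * ∏ x ∈ W, u x = ∏ x, (p * u x + (1 - p)) := by
  rw [Finset.prod_add]
  refine Finset.sum_congr rfl fun W _ => ?_
  rw [Finset.prod_mul_distrib, Finset.prod_const, Finset.prod_const,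
    Finset.card_sdiff_of_subset (Finset.subset_univ W), Finset.card_univ, ZMod.card]
  ring

lemma sum_bernoulliWeight (p : ℝ) :
    ∑ W ∈ (univ : Finset (ZMod N)).powerset, p ^ W.card * (1 - p) ^ (N - W.card) = 1 := by
  have h := sum_bernoulliWeight_mul_prod (N := N) p (fun _ => 1)
  simpa using h

lemma randomSetProb_mono {p : ℝ} (hp0 : 0 ≤ p) (hp1 : p ≤ 1) {E F : Finset (ZMod N) → Prop}
    (h : ∀ W, E W → F W) : randomSetProb N p E ≤ randomSetProb N p F := by
  refine Finset.sum_le_sum fun W _ => ?_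
  have := bernoulliWeight_nonneg hp0 hp1 W
  by_cases hE : E W
  · rw [if_pos hE, if_pos (h W hE)]
  · rw [if_neg hE]
    split_ifs <;> simp [this]

lemma sum_bernoulliWeight_mul_exp_le {p : ℝ} (hp0 : 0 ≤ p) (hp1 : p ≤ 1) {c : ZMod N → ℝ}
    (hc : ∀ x, |c x| ≤ 1) {l : ℝ} (hl0 : 0 ≤ l) (hl1 : l ≤ 1) (s : ℝ) :
    ∑ W ∈ (univ : Finset (ZMod N)).powerset, p ^ W.card * (1 - p) ^ (N - W.card) *
      Real.exp (l * (∑ x ∈ W, c x - p * ∑ x, c x - s)) ≤ Real.exp (N * l ^ 2 - l * s) := by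
  have h1 : ∀ W : Finset (ZMod N), p ^ W.card * (1 - p) ^ (N - W.card) *
      Real.exp (l * (∑ x ∈ W, c x - p * ∑ x, c x - s)) =
      Real.exp (-(l * p * ∑ x, c x) - l * s) *
        (p ^ W.card * (1 - p) ^ (N - W.card) * ∏ x ∈ W, Real.exp (l * c x)) := by
    intro W
    rw [← Real.exp_sum, ← Finset.mul_sum]
    rw [mul_left_comm, ← Real.exp_add]
    congr 2
    ring
  simp_rw [h1]
  rw [← Finset.mul_sum, sum_bernoulliWeight_mul_prod]
  have h2 : ∏ x, (p * Real.exp (l * c x) + (1 - p)) ≤ Real.exp (l * p * ∑ x, c x + N * l ^ 2) := by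
    have e : l * p * ∑ x, c x + N * l ^ 2 = ∑ x : ZMod N, (l * p * c x + l ^ 2) := by
      rw [Finset.sum_add_distrib, ← Finset.mul_sum, Finset.sum_const, Finset.card_univ, ZMod.card,
        nsmul_eq_mul]
    rw [e, Real.exp_sum]
    refine Finset.prod_le_prod (fun x _ => ?_) fun x _ => ?_
    · have := Real.exp_pos (l * c x)
      have := sub_nonneg.mpr hp1
      positivity
    · have hy : |l * c x| ≤ 1 := by
        rw [abs_mul, abs_of_nonneg hl0]
        exact mul_le_one₀ hl1 (abs_nonneg _) (hc x)
      have hexp := (abs_le.mp (Real.abs_exp_sub_one_sub_id_le hy)).2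
      have hsq : (l * c x) ^ 2 ≤ l ^ 2 := by
        rw [mul_pow]
        exact mul_le_of_le_one_right (sq_nonneg l) ((sq_le_one_iff_abs_le_one _).mpr (hc x))
      have hadd := Real.add_one_le_exp (l * p * c x + l ^ 2)
      have h3 : p * (Real.exp (l * c x) - 1 - l * c x) ≤ l ^ 2 := by
        calc p * (Real.exp (l * c x) - 1 - l * c x) ≤ p * l ^ 2 := by gcongr; linarith
          _ ≤ l ^ 2 := mul_le_of_le_one_left (sq_nonneg l) hp1
      linarith
  calc _ ≤ Real.exp (-(l * p * ∑ x, c x) - l * s) *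
        Real.exp (l * p * ∑ x, c x + N * l ^ 2) := by gcongr
    _ = _ := by
      rw [← Real.exp_add]
      congr 1
      ring

/-- Simultaneous concentration of finitely many bounded linear statistics of a random set. -/
lemma one_sub_le_randomSetProb_abs_le {ι : Type*} [Fintype ι] {p : ℝ} (hp0 : 0 ≤ p) (hp1 : p ≤ 1)
    {c : ι → ZMod N → ℝ} (hc : ∀ i x, |c i x| ≤ 1) {l : ℝ} (hl0 : 0 ≤ l) (hl1 : l ≤ 1) (s : ℝ) :
    1 - 2 * Fintype.card ι * Real.exp (N * l ^ 2 - l * s) ≤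
      randomSetProb N p (fun W => ∀ i, |∑ x ∈ W, c i x - p * ∑ x, c i x| ≤ s) := by
  have hkey : ∀ W : Finset (ZMod N), p ^ W.card * (1 - p) ^ (N - W.card) ≤
      (if ∀ i, |∑ x ∈ W, c i x - p * ∑ x, c i x| ≤ s then
        p ^ W.card * (1 - p) ^ (N - W.card) else 0) +
      ∑ i, (p ^ W.card * (1 - p) ^ (N - W.card) *
          Real.exp (l * (∑ x ∈ W, c i x - p * ∑ x, c i x - s)) +
        p ^ W.card * (1 - p) ^ (N - W.card) *
          Real.exp (l * (∑ x ∈ W, -c i x - p * ∑ x, -c i x - s))) := by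
    intro W
    have hw := bernoulliWeight_nonneg hp0 hp1 W
    set w := p ^ W.card * (1 - p) ^ (N - W.card)
    split_ifs with h
    · exact le_add_of_nonneg_right (Finset.sum_nonneg fun i _ => by positivity)
    · push Not at h
      obtain ⟨i, hi⟩ := h
      rw [zero_add]
      refine le_trans ?_ (Finset.single_le_sum (fun i _ => by positivity) (Finset.mem_univ i))
      simp only [Finset.sum_neg_distrib]
      rcases lt_abs.mp hi with h | h
      · have h1 : 1 ≤ Real.exp (l * (∑ x ∈ W, c i x - p * ∑ x, c i x - s)) :=
          Real.one_le_exp (mul_nonneg hl0 (by linarith))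
        have h2 := mul_le_mul_of_nonneg_left h1 hw
        have h3 : 0 ≤ w * Real.exp (l * (-∑ x ∈ W, c i x - p * -∑ x, c i x - s)) := by positivity
        linarith
      · have h1 : 1 ≤ Real.exp (l * (-∑ x ∈ W, c i x - p * -∑ x, c i x - s)) :=
          Real.one_le_exp (mul_nonneg hl0 (by linarith))
        have h2 := mul_le_mul_of_nonneg_left h1 hw
        have h3 : 0 ≤ w * Real.exp (l * (∑ x ∈ W, c i x - p * ∑ x, c i x - s)) := by positivity
        linarith
  have hsum := Finset.sum_le_sum fun W (_ : W ∈ (univ : Finset (ZMod N)).powerset) => hkey W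
  rw [sum_bernoulliWeight, Finset.sum_add_distrib, Finset.sum_comm] at hsum
  have hbd : ∑ i, ∑ W ∈ (univ : Finset (ZMod N)).powerset,
      (p ^ W.card * (1 - p) ^ (N - W.card) *
          Real.exp (l * (∑ x ∈ W, c i x - p * ∑ x, c i x - s)) +
        p ^ W.card * (1 - p) ^ (N - W.card) *
          Real.exp (l * (∑ x ∈ W, -c i x - p * ∑ x, -c i x - s))) ≤
      2 * Fintype.card ι * Real.exp (N * l ^ 2 - l * s) := by
    calc _ ≤ ∑ _i : ι, 2 * Real.exp (N * l ^ 2 - l * s) := by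
          refine Finset.sum_le_sum fun i _ => ?_
          rw [Finset.sum_add_distrib, two_mul]
          exact add_le_add (sum_bernoulliWeight_mul_exp_le hp0 hp1 (hc i) hl0 hl1 s)
            (sum_bernoulliWeight_mul_exp_le hp0 hp1 (c := fun x => -c i x)
              (fun x => by rw [abs_neg]; exact hc i x) hl0 hl1 s)
      _ = _ := by
          rw [Finset.sum_const, Finset.card_univ, nsmul_eq_mul]
          ring
  rw [sub_le_iff_le_add]
  refine hsum.trans (add_le_add (le_of_eq ?_) hbd)
  unfold randomSetProb
  refine Finset.sum_congr rfl fun W _ => ?_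
  congr

/-- With high probability a random set has nearly the expected size and small nontrivial
exponential sums. -/
lemma one_sub_le_randomSetProb_pseudorandom {p : ℝ} (hp0 : 0 ≤ p) (hp1 : p ≤ 1) {l : ℝ}
    (hl0 : 0 ≤ l) (hl1 : l ≤ 1) (s : ℝ) :
    1 - 4 * N * Real.exp (N * l ^ 2 - l * s) ≤
      randomSetProb N p (fun W => |(W.card : ℝ) - p * N| ≤ s ∧
        ∀ t : ZMod N, t ≠ 0 → ‖expSum W t‖ ≤ 2 * s) := by
  set c : ZMod N × Bool → ZMod N → ℝ := fun i x =>
    if i.2 then (ZMod.stdAddChar (i.1 * x) : ℂ).re else (ZMod.stdAddChar (i.1 * x) : ℂ).im with hcdef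
  have hc : ∀ i x, |c i x| ≤ 1 := by
    intro i x
    rw [← AddChar.norm_apply (ZMod.stdAddChar (N := N)) (i.1 * x)]
    simp only [hcdef]
    split_ifs
    · exact Complex.abs_re_le_norm _
    · exact Complex.abs_im_le_norm _
  have h := one_sub_le_randomSetProb_abs_le hp0 hp1 hc hl0 hl1 s
  rw [Fintype.card_prod, ZMod.card, Fintype.card_bool] at h
  refine le_trans (le_of_eq (by push_cast; ring)) (h.trans (randomSetProb_mono hp0 hp1 ?_))
  intro W hW
  refine ⟨?_, fun t ht => ?_⟩
  · have h0 := hW (0, true)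
    simpa [hcdef] using h0
  · have hre := hW (t, true)
    have him := hW (t, false)
    have hu := expSum_univ t
    rw [if_neg ht] at hu
    simp only [hcdef, if_true, Bool.false_eq_true, if_false, ← Complex.re_sum,
      ← Complex.im_sum] at hre him
    unfold expSum at hu ⊢
    rw [hu] at hre him
    simp only [Complex.zero_re, Complex.zero_im, mul_zero, sub_zero] at hre him
    refine (Complex.norm_le_abs_re_add_abs_im _).trans ?_
    linarith

end RandomSet

/-- Long arithmetic progressions in sumsets of dense subsets of random sets:
for suitable absolute constants `C₁, C₂`, with probability `1 - o_{k,α}(1)`, for every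
`A ⊆ W` with `|A| ≥ α|W|` the sumset `A + A` contains a nontrivial `k`-term arithmetic
progression, provided `α ≥ C₁ log log N / √(log N)` and
`k ≤ exp(α² log log N / (C₂ log(1/α)(log log log N + log(1/α))))`. -/
theorem long_aps_in_sumsets_of_random_sets :
    ∃ C₁ C₂ : ℝ, 0 < C₁ ∧ 0 < C₂ ∧
      ∀ θ C : ℝ, 0 < θ → θ < 1 / 140 → 0 < C →
        ∀ α : ℝ, 0 < α → α ≤ 1 → ∀ k : ℕ, 3 ≤ k →
          ∀ ε : ℝ, 0 < ε → ∃ N₀ : ℕ, ∀ N : ℕ, N₀ ≤ N → N.Prime → ∀ [NeZero N],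
            C₁ * Real.log (Real.log N) / Real.sqrt (Real.log N) ≤ α →
            (k : ℝ) ≤ Real.exp (α ^ 2 * Real.log (Real.log N) /
              (C₂ * Real.log (1 / α) *
                (Real.log (Real.log (Real.log N)) + Real.log (1 / α)))) →
            ∀ p : ℝ, C * (N : ℝ) ^ (-θ) < p → p ≤ 1 →
              1 - ε ≤ randomSetProb N p (fun W =>
                ∀ A ⊆ W, α * (W.card : ℝ) ≤ (A.card : ℝ) →
                  ∃ a d : ZMod N, d ≠ 0 ∧
                    ∀ i : ℕ, i < k → a + (i : ZMod N) * d ∈ A + A) := by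
  refine ⟨1, 1, one_pos, one_pos, fun θ C _ hθ hC α hα _ k hk ε hε => ?_⟩
  obtain ⟨N₁, hN₁⟩ := exists_progression_of_pseudorandom hα (k := k) (by omega)
  set K : ℝ := 3200 * k ^ 2 / α ^ 4 with hK
  have hK0 : 0 ≤ K := by positivity
  have hm : Filter.Tendsto (fun N : ℕ => (N : ℝ) ^ (1 / 4 : ℝ)) Filter.atTop Filter.atTop :=
    (tendsto_rpow_atTop (by norm_num)).comp tendsto_natCast_atTop_atTop
  have hr : Filter.Tendsto (fun N : ℕ => C ^ 3 * (N : ℝ) ^ (1 / 8 : ℝ))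
      Filter.atTop Filter.atTop :=
    ((tendsto_rpow_atTop (by norm_num)).comp tendsto_natCast_atTop_atTop).const_mul_atTop
      (by positivity)
  have hexp : Filter.Tendsto (fun N : ℕ => 64 * (((N : ℝ) ^ (1 / 4 : ℝ)) ^ 2 / 4) ^ 2 *
      Real.exp (-(((N : ℝ) ^ (1 / 4 : ℝ)) ^ 2 / 4))) Filter.atTop (nhds 0) := by
    have h1 := (((Real.tendsto_pow_mul_exp_neg_atTop_nhds_zero 2).comp
      (((Filter.tendsto_pow_atTop (two_ne_zero)).comp hm).atTop_div_const
        (by norm_num : (0 : ℝ) < 4))).const_mul 64)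
    simpa [Function.comp_def, mul_assoc] using h1
  have hev := (hm.eventually_ge_atTop 1).and ((hr.eventually_ge_atTop (2 * K + 2)).and
    ((hexp.eventually_le_const hε).and (Filter.eventually_ge_atTop N₁)))
  obtain ⟨N₀, hN₀⟩ := Filter.eventually_atTop.mp hev
  refine ⟨N₀, fun N hN _ _ _ _ p hp hp1 => ?_⟩
  obtain ⟨hm1, hr1, hexp1, hNN₁⟩ := hN₀ N hN
  have hNpos : (1 : ℝ) ≤ N := by exact_mod_cast Nat.pos_of_neZero N
  have hN0 : (0 : ℝ) < N := by linarith
  set m : ℝ := (N : ℝ) ^ (1 / 4 : ℝ) with hmdef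
  have hm0 : 0 < m := by linarith
  have hNm : (N : ℝ) = m ^ 4 := by
    rw [hmdef, ← Real.rpow_natCast, ← Real.rpow_mul hN0.le]
    norm_num
  have hp0 : 0 < p := lt_trans (by positivity) hp
  have hpm : 2 * K + 2 ≤ p ^ 3 * m := by
    calc 2 * K + 2 ≤ C ^ 3 * (N : ℝ) ^ (1 / 8 : ℝ) := hr1
      _ = (C * (N : ℝ) ^ (-(1 / 24) : ℝ)) ^ 3 * m := by
        rw [mul_pow, ← Real.rpow_natCast ((N : ℝ) ^ (-(1 / 24) : ℝ)), ← Real.rpow_mul hN0.le,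
          mul_assoc, hmdef, ← Real.rpow_add hN0]
        norm_num
      _ ≤ (C * (N : ℝ) ^ (-θ)) ^ 3 * m := by
        gcongr
        linarith
      _ ≤ p ^ 3 * m := by gcongr
  have hpm' : 2 ≤ p * m := by
    have h1 : p ^ 3 ≤ p := pow_le_of_le_one hp0.le hp1 (by norm_num)
    nlinarith [mul_le_mul_of_nonneg_right h1 hm0.le]
  have hprob := one_sub_le_randomSetProb_pseudorandom (N := N) hp0.le hp1
    (l := 1 / (2 * m)) (by positivity) (by rw [div_le_one (by positivity)]; linarith) (m ^ 3)
  have hbound : 4 * N * Real.exp (N * (1 / (2 * m)) ^ 2 - 1 / (2 * m) * m ^ 3) ≤ ε := by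
    have e1 : (N : ℝ) * (1 / (2 * m)) ^ 2 - 1 / (2 * m) * m ^ 3 = -(m ^ 2 / 4) := by
      rw [hNm]
      field_simp
      ring
    rw [e1]
    refine le_trans (le_of_eq ?_) hexp1
    rw [hNm]
    ring
  refine le_trans (by linarith) (hprob.trans (randomSetProb_mono hp0.le hp1 ?_))
  rintro W ⟨hW, hWt⟩ A hAW hA
  refine hN₁ N hNN₁ (p * N) (2 * m ^ 3) (by positivity) ?_ (by positivity) ?_ W (hW.trans ?_)
    hWt A hAW hA
  · exact mul_le_of_le_one_left hN0.le hp1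
  · rw [hNm]
    have h2K : 2 * K ≤ p ^ 3 * m := by linarith
    calc K * (2 * m ^ 3 * (m ^ 4) ^ 2) = 2 * K * m ^ 11 := by ring
      _ ≤ p ^ 3 * m * m ^ 11 := mul_le_mul_of_nonneg_right h2K (by positivity)
      _ = _ := by ring
  · rw [hNm]
    nlinarith [mul_le_mul_of_nonneg_right hpm' (by positivity : 0 ≤ m ^ 3)]
end

section
/- (Varnavides-type theorem for square differences.) For every 0 < δ ≤ 1 there is a constant c(δ) > 0 and a function o_δ(1) tending to 0 as N → ∞ such that the following holds: for every prime N ≥ 1 and every function f : Z_N → [0,1] with E f ≥ δ, one has E( f(n) f(n + r²) : n ∈ Z_N, r ∈ Z_N with 1 ≤ r ≤ ⌊√(N/3)⌋ ) ≥ c(δ) − o_δ(1); here the expectation is the average of f(n) f(n + r²) over all n ∈ Z_N and all integers r with 1 ≤ r ≤ ⌊√(N/3)⌋, with n + r² computed in Z_N. -/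
open scoped BigOperators

/-- **Van der Corput's lemma**, for sequences whose self-correlations have bounded partial sums. -/
lemma tendsto_average_zero_of_correlation_bounded {u : ℕ → ℂ} (hu : ∀ k, ‖u k‖ ≤ 1)
    (hcorr : ∀ h h' : ℕ, h ≠ h' → ∃ C : ℝ, ∀ L : ℕ,
      ‖∑ k ∈ Finset.range L, u (k + h) * starRingEnd ℂ (u (k + h'))‖ ≤ C) :
    Filter.Tendsto (fun L : ℕ => (∑ k ∈ Finset.range L, u k) / (L : ℂ))
      Filter.atTop (nhds 0) := by
  have hshift : ∀ L h : ℕ,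
      ‖(∑ k ∈ Finset.range L, u (k + h)) - ∑ k ∈ Finset.range L, u k‖ ≤ 2 * h := by
    intro L h
    induction h with
    | zero => simp
    | succ h ih =>
      have e : (∑ k ∈ Finset.range L, u (k + (h + 1))) - ∑ k ∈ Finset.range L, u k
          = (u (L + h) - u h) +
            ((∑ k ∈ Finset.range L, u (k + h)) - ∑ k ∈ Finset.range L, u k) := by
        have := Finset.sum_range_succ' (fun k => u (k + h)) L
        rw [Finset.sum_range_succ] at this
        have h2 : ∑ k ∈ Finset.range L, u (k + (h + 1))
            = ∑ k ∈ Finset.range L, u (k + 1 + h) :=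
          Finset.sum_congr rfl fun k _ => by congr 1; ring
        rw [zero_add] at this
        rw [h2]
        linear_combination -this
      rw [e]
      refine (norm_add_le _ _).trans ?_
      have := norm_sub_le (u (L + h)) (u h)
      have := hu (L + h)
      have := hu h
      push_cast
      linarith
  choose! C hC using hcorr
  have key : ∀ H L : ℕ, 0 < H → 0 < L →
      ‖(∑ k ∈ Finset.range L, u k) / (L : ℂ)‖ ≤
        2 * H / L + √(1 / H + (∑ p ∈ Finset.range H ×ˢ Finset.range H, |C p.1 p.2|) / L) := by
    intro H L hH hL
    set D := ∑ p ∈ Finset.range H ×ˢ Finset.range H, |C p.1 p.2| with hD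
    have hH' : (1 : ℝ) ≤ H := by exact_mod_cast hH
    have hL' : (0 : ℝ) < L := by exact_mod_cast hL
    have hD0 : 0 ≤ D := Finset.sum_nonneg fun _ _ => abs_nonneg _
    set S := ∑ k ∈ Finset.range L, u k with hS
    set V := ∑ k ∈ Finset.range L, ∑ h ∈ Finset.range H, u (k + h) with hV
    have h1 : ‖(H : ℂ) * S - V‖ ≤ 2 * H * H := by
      have : (H : ℂ) * S - V
          = ∑ h ∈ Finset.range H, (S - ∑ k ∈ Finset.range L, u (k + h)) := by
        rw [hV, Finset.sum_comm, Finset.sum_sub_distrib]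
        simp
      rw [this]
      refine (norm_sum_le _ _).trans ?_
      calc _ ≤ ∑ h ∈ Finset.range H, (2 * H : ℝ) := by
            refine Finset.sum_le_sum fun h hh => ?_
            rw [norm_sub_rev]
            refine (hshift L h).trans ?_
            have : (h : ℝ) ≤ H := by exact_mod_cast (Finset.mem_range.1 hh).le
            linarith
        _ = 2 * H * H := by simp; ring
    have h2 : ∑ k ∈ Finset.range L, ‖∑ h ∈ Finset.range H, u (k + h)‖ ^ 2 ≤ H * L + D := by
      have e : ((∑ k ∈ Finset.range L, ‖∑ h ∈ Finset.range H, u (k + h)‖ ^ 2 : ℝ) : ℂ)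
          = ∑ p ∈ Finset.range H ×ˢ Finset.range H,
              ∑ k ∈ Finset.range L, u (k + p.1) * starRingEnd ℂ (u (k + p.2)) := by
        rw [Finset.sum_comm]
        push_cast
        refine Finset.sum_congr rfl fun k _ => ?_
        rw [← Complex.mul_conj', map_sum, Finset.sum_mul_sum, Finset.sum_product]
      have hnn : 0 ≤ ∑ k ∈ Finset.range L, ‖∑ h ∈ Finset.range H, u (k + h)‖ ^ 2 :=
        Finset.sum_nonneg fun _ _ => by positivity
      rw [← abs_of_nonneg hnn, ← Real.norm_eq_abs, ← Complex.norm_real, e]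
      refine (norm_sum_le _ _).trans ?_
      calc _ ≤ ∑ p ∈ Finset.range H ×ˢ Finset.range H,
              ((if p.1 = p.2 then (L : ℝ) else 0) + |C p.1 p.2|) := by
            refine Finset.sum_le_sum fun p _ => ?_
            split_ifs with hp
            · refine ((norm_sum_le _ _).trans (?_ : _ ≤ (L : ℝ))).trans
                (le_add_of_nonneg_right (abs_nonneg _))
              calc _ ≤ ∑ k ∈ Finset.range L, (1 : ℝ) := by
                    refine Finset.sum_le_sum fun k _ => ?_
                    rw [norm_mul, RCLike.norm_conj]
                    exact mul_le_one₀ (hu _) (norm_nonneg _) (hu _)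
                _ = L := by simp
            · rw [zero_add]
              exact (hC _ _ hp L).trans (le_abs_self _)
        _ = H * L + D := by
            rw [Finset.sum_add_distrib, Finset.sum_product]
            congr 1
            rw [Finset.sum_congr rfl fun x hx => (Finset.sum_ite_eq _ x _).trans (if_pos hx)]
            simp
    have h3 : ‖V‖ ^ 2 ≤ L * (H * L + D) := by
      calc ‖V‖ ^ 2 ≤ (∑ k ∈ Finset.range L, ‖∑ h ∈ Finset.range H, u (k + h)‖) ^ 2 := by
            gcongr
            exact norm_sum_le _ _
        _ ≤ L * ∑ k ∈ Finset.range L, ‖∑ h ∈ Finset.range H, u (k + h)‖ ^ 2 := by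
            simpa using sq_sum_le_card_mul_sum_sq (s := Finset.range L)
              (f := fun k => ‖∑ h ∈ Finset.range H, u (k + h)‖)
        _ ≤ _ := by gcongr
    have h4 : ‖V‖ ≤ H * L * √(1 / H + D / L) := by
      refine le_of_sq_le_sq ?_ (by positivity)
      rw [mul_pow, Real.sq_sqrt (by positivity)]
      refine h3.trans ?_
      have e : ((H : ℝ) * L) ^ 2 * (1 / H + D / L) = L * (H * L + H * H * D) := by
        field_simp
      rw [e]
      gcongr
      exact le_mul_of_one_le_left hD0 (one_le_mul_of_one_le_of_one_le hH' hH')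
    have h5 : H * ‖S‖ ≤ 2 * H * H + H * L * √(1 / H + D / L) := by
      have := norm_add_le ((H : ℂ) * S - V) V
      rw [sub_add_cancel, norm_mul, Complex.norm_natCast] at this
      linarith
    rw [norm_div, Complex.norm_natCast, div_le_iff₀ hL']
    have e2 : (2 * H / L + √(1 / H + D / L)) * L = 2 * H + L * √(1 / H + D / L) := by
      field_simp
    rw [e2]
    refine le_of_mul_le_mul_left ?_ (by linarith : (0 : ℝ) < H)
    linarith
  rw [Metric.tendsto_atTop']
  intro ε hε
  obtain ⟨H, hH⟩ := exists_nat_gt (1 / ε ^ 2)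
  have hH0 : (0 : ℝ) < H := lt_trans (by positivity) hH
  have hlim : Filter.Tendsto (fun L : ℕ => 2 * (H : ℝ) / L +
      √(1 / H + (∑ p ∈ Finset.range H ×ˢ Finset.range H, |C p.1 p.2|) / L))
      Filter.atTop (nhds (0 + √(1 / H + 0))) := by
    refine (tendsto_const_div_atTop_nhds_zero_nat _).add ?_
    refine (Real.continuous_sqrt.tendsto _).comp ?_
    exact tendsto_const_nhds.add (tendsto_const_div_atTop_nhds_zero_nat _)
  have hlt : 0 + √(1 / (H : ℝ) + 0) < ε := by
    rw [zero_add, add_zero, Real.sqrt_lt' hε]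
    rw [div_lt_iff₀ (by positivity)] at hH ⊢
    linarith
  obtain ⟨L₀, hL₀⟩ := Filter.eventually_atTop.1 (hlim.eventually_lt_const hlt)
  refine ⟨L₀, fun L hL => ?_⟩
  rw [dist_zero_right]
  exact (key H L (by exact_mod_cast hH0) (by omega)).trans_lt (hL₀ L hL.le)

/-- **Weyl equidistribution** for squares, in the form of vanishing exponential averages. -/
lemma tendsto_average_pow_sq_zero {z : Circle} (hz : ¬ IsOfFinOrder z) :
    Filter.Tendsto (fun L : ℕ => (∑ k ∈ Finset.range L, ((z ^ (k + 1) ^ 2 : Circle) : ℂ)) / (L : ℂ))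
      Filter.atTop (nhds 0) := by
  refine tendsto_average_zero_of_correlation_bounded (fun k => (Circle.norm_coe _).le) ?_
  intro h h' hne
  set A : Circle := z ^ (1 + h) ^ 2 * (z ^ (1 + h') ^ 2)⁻¹ with hA
  set B : Circle := z ^ (2 * h) * (z ^ (2 * h'))⁻¹ with hB
  have hB1 : (B : ℂ) ≠ 1 := by
    intro hb
    have hb' : B = 1 := Circle.ext (by simpa using hb)
    rw [hB, mul_inv_eq_one] at hb'
    have := injective_pow_iff_not_isOfFinOrder.2 hz hb'
    omega
  have hterm : ∀ k : ℕ, ((z ^ (k + h + 1) ^ 2 : Circle) : ℂ)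
      * starRingEnd ℂ ((z ^ (k + h' + 1) ^ 2 : Circle) : ℂ) = A * (B : ℂ) ^ k := by
    intro k
    rw [← Circle.coe_inv_eq_conj, ← Circle.coe_mul, ← Circle.coe_pow, ← Circle.coe_mul]
    congr 1
    have e : ∀ m : ℕ, z ^ (k + m + 1) ^ 2
        = z ^ (k ^ 2 + 2 * k) * ((z ^ (2 * m)) ^ k * z ^ (1 + m) ^ 2) := by
      intro m
      rw [← pow_mul, ← pow_add, ← pow_add]
      congr 1
      ring
    rw [e h, e h', hA, hB, mul_pow, inv_pow, mul_inv, mul_inv, mul_mul_mul_comm,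
      mul_inv_cancel, one_mul, mul_mul_mul_comm, mul_comm]
  refine ⟨2 / ‖(B : ℂ) - 1‖, fun L => ?_⟩
  simp_rw [hterm]
  rw [← Finset.mul_sum, geom_sum_eq hB1, norm_mul, Circle.norm_coe, one_mul, norm_div]
  gcongr
  refine (norm_sub_le _ _).trans ?_
  simp [Circle.norm_coe]
  norm_num

open MeasureTheory in
/-- A finite measure on the circle cannot have all its Fourier coefficients at nonzero squares
bounded above by the same negative number. -/
lemma nonpos_of_integral_pow_sq_le_neg [MeasurableSpace Circle] [BorelSpace Circle]
    (μ : Measure Circle) [IsFiniteMeasure μ] {c : ℝ}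
    (h : ∀ k : ℕ, 1 ≤ k → ∫ z, ((z ^ k ^ 2 : Circle) : ℂ).re ∂μ ≤ -c) : c ≤ 0 := by
  have hcont : ∀ m : ℕ, Continuous fun z : Circle => ((z ^ m : Circle) : ℂ).re := fun m => by
    fun_prop
  have hbound : ∀ (m : ℕ) (z : Circle), |((z ^ m : Circle) : ℂ).re| ≤ 1 := fun m z =>
    (Complex.abs_re_le_norm _).trans (Circle.norm_coe _).le
  set F : ℕ → ℕ → Circle → ℝ := fun j L z =>
    (∑ k ∈ Finset.range L, ((z ^ (j.factorial * (k + 1)) ^ 2 : Circle) : ℂ).re) / L with hF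
  have hFcont : ∀ j L, Continuous (F j L) := fun j L =>
    (continuous_finsetSum _ fun k _ => hcont _).div_const _
  have hFbound : ∀ j L z, |F j L z| ≤ 1 := by
    intro j L z
    rw [hF, abs_div, Nat.abs_cast]
    refine div_le_one_of_le₀ ((Finset.abs_sum_le_sum_abs _ _).trans ?_) (by positivity)
    calc _ ≤ ∑ k ∈ Finset.range L, (1 : ℝ) := Finset.sum_le_sum fun k _ => hbound _ _
      _ = L := by simp
  have hFint : ∀ j L, Integrable (F j L) μ := fun j L =>
    Integrable.of_bound (hFcont j L).aestronglyMeasurable 1 (ae_of_all _ (hFbound j L))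
  have hFle : ∀ j L, 0 < L → ∫ z, F j L z ∂μ ≤ -c := by
    intro j L hL
    have hL' : (0 : ℝ) < L := by exact_mod_cast hL
    rw [hF, integral_div, integral_finsetSum _ fun k _ =>
      Integrable.of_bound (hcont _).aestronglyMeasurable 1 (ae_of_all _ (hbound _)),
      div_le_iff₀ hL']
    calc _ ≤ ∑ k ∈ Finset.range L, -c := Finset.sum_le_sum fun k _ =>
          h _ (Nat.mul_pos j.factorial_pos k.succ_pos)
      _ = -c * L := by simp; ring
  set E : ℕ → Set Circle := fun j => {z | IsOfFinOrder z ∧ z ^ j.factorial ≠ 1} with hE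
  have hpow : ∀ n : ℕ, MeasurableSet {z : Circle | z ^ n = 1} := fun n =>
    (isClosed_eq (continuous_pow n) continuous_const).measurableSet
  have hEmeas : ∀ j, MeasurableSet (E j) := by
    intro j
    refine MeasurableSet.inter ?_ (hpow _).compl
    have : {z : Circle | IsOfFinOrder z} = ⋃ n : ℕ, {z : Circle | 0 < n ∧ z ^ n = 1} := by
      ext z
      simp [isOfFinOrder_iff_pow_eq_one]
    change MeasurableSet {z : Circle | IsOfFinOrder z}
    rw [this]
    exact MeasurableSet.iUnion fun n => (MeasurableSet.const _).inter (hpow n)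
  have hlim : ∀ j z, Filter.Tendsto (fun L => (E j)ᶜ.indicator (F j L) z) Filter.atTop
      (nhds ({z : Circle | z ^ j.factorial = 1}.indicator 1 z)) := by
    intro j z
    by_cases h1 : z ^ j.factorial = 1
    · have hz : z ∈ (E j)ᶜ := fun hz => hz.2 h1
      simp only [Set.indicator_of_mem hz]
      rw [Set.indicator_of_mem (by exact h1), Pi.one_apply]
      refine tendsto_const_nhds.congr' ?_
      filter_upwards [Filter.eventually_gt_atTop 0] with L hL
      have : ∀ k, z ^ (j.factorial * (k + 1)) ^ 2 = 1 := fun k => by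
        rw [mul_pow, pow_two, mul_assoc, pow_mul, h1, one_pow]
      simp only [hF, this]
      simp [hL.ne']
    · rw [Set.indicator_of_notMem (by exact h1)]
      by_cases h2 : IsOfFinOrder z
      · have hz : z ∉ (E j)ᶜ := fun hz => hz ⟨h2, h1⟩
        simp [Set.indicator_of_notMem hz]
      · have hz : z ∈ (E j)ᶜ := fun hz => h2 hz.1
        simp only [Set.indicator_of_mem hz]
        have hw : ¬ IsOfFinOrder (z ^ j.factorial ^ 2) := fun hw =>
          h2 (hw.of_pow (pow_ne_zero _ j.factorial_ne_zero))
        have := (Complex.continuous_re.tendsto 0).comp (tendsto_average_pow_sq_zero hw)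
        refine this.congr fun L => ?_
        rw [Function.comp_apply, ← Complex.ofReal_natCast, Complex.div_ofReal_re, Complex.re_sum]
        simp_rw [hF, mul_pow, pow_mul]
  have hle : ∀ j, c ≤ ∫ z, (E j).indicator 1 z ∂μ := by
    intro j
    have hindE : Integrable ((E j).indicator (1 : Circle → ℝ)) μ :=
      (integrable_const 1).indicator (hEmeas j)
    have hT := tendsto_integral_of_dominated_convergence (μ := μ) (fun _ => (1 : ℝ))
      (fun L => ((hFint j L).indicator (hEmeas j).compl).aestronglyMeasurable)
      (integrable_const 1)
      (fun L => ae_of_all _ fun z => (Set.indicator_le_self' (fun _ _ => norm_nonneg _) z).trans'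
        (norm_indicator_eq_indicator_norm _ _).le |>.trans (hFbound j L z))
      (ae_of_all _ (hlim j))
    have hup : ∀ᶠ L in Filter.atTop, ∫ z, (E j)ᶜ.indicator (F j L) z ∂μ
        ≤ -c + ∫ z, (E j).indicator 1 z ∂μ := by
      filter_upwards [Filter.eventually_gt_atTop 0] with L hL
      refine le_trans ?_ (add_le_add_left (hFle j L hL) _)
      rw [← integral_add (hFint j L) hindE]
      refine integral_mono ((hFint j L).indicator (hEmeas j).compl) ((hFint j L).add hindE) ?_
      intro z
      have := (abs_le.1 (hFbound j L z)).1
      by_cases hz : z ∈ E j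
      · simp [hz]
        linarith
      · simp [hz]
    have h0 : 0 ≤ ∫ z, {z : Circle | z ^ j.factorial = 1}.indicator (1 : Circle → ℝ) z ∂μ :=
      integral_nonneg fun z => Set.indicator_nonneg (fun _ _ => zero_le_one) z
    have := le_of_tendsto hT hup
    linarith
  have hT : Filter.Tendsto (fun j => ∫ z, (E j).indicator (1 : Circle → ℝ) z ∂μ) Filter.atTop
      (nhds (∫ _, (0 : ℝ) ∂μ)) := by
    refine tendsto_integral_of_dominated_convergence (fun _ => (1 : ℝ))
      (fun j => ((integrable_const 1).indicator (hEmeas j)).aestronglyMeasurable)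
      (integrable_const 1) (fun j => ae_of_all _ fun z => ?_) (ae_of_all _ fun z => ?_)
    · by_cases hz : z ∈ E j <;> simp [hz]
    · refine tendsto_const_nhds.congr' ?_
      filter_upwards [Filter.eventually_ge_atTop (orderOf z)] with j hj
      have hz : z ∉ E j := fun hz =>
        hz.2 (orderOf_dvd_iff_pow_eq_one.1 (Nat.dvd_factorial hz.1.orderOf_pos hj))
      simp [hz]
  rw [integral_zero] at hT
  exact ge_of_tendsto' hT hle

/-- Convex combinations of the characters `z ↦ z ^ k ^ 2`, `k ≥ 1`, have real parts bounded below
by arbitrarily small negative constants. In other words, the set of nonzero squares is a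
van der Corput set in the sense of Kamae and Mendès France. -/
lemma exists_square_trigonometric_combination {ε : ℝ} (hε : 0 < ε) :
    ∃ (ι : Type) (_ : Fintype ι) (a : ι → ℝ) (k : ι → ℕ), (∀ i, 0 ≤ a i) ∧ ∑ i, a i = 1 ∧
      (∀ i, 1 ≤ k i) ∧ ∀ z : Circle, -ε ≤ ∑ i, a i * ((z ^ k i ^ 2 : Circle) : ℂ).re := by
  let _ : MeasurableSpace Circle := borel Circle
  have _ : BorelSpace Circle := ⟨rfl⟩
  let G : ℕ → C(Circle, ℝ) := fun k => ⟨fun z => ((z ^ (k + 1) ^ 2 : Circle) : ℂ).re, by fun_prop⟩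
  let s : Set C(Circle, ℝ) := {g | ∀ z, -ε < g z}
  have hs_open : IsOpen s := by
    have := ContinuousMap.isOpen_setOfPred_mapsTo (X := Circle) (Y := ℝ) isCompact_univ
      (isOpen_Ioi (a := -ε))
    convert this using 1
    ext g
    simp [s, Set.MapsTo]
  have hs_convex : Convex ℝ s := by
    intro g hg g' hg' a b ha hb hab z
    exact (convex_Ioi (-ε)) (hg z) (hg' z) ha hb hab
  by_cases hdisj : Disjoint s (convexHull ℝ (Set.range G))
  · exfalso
    obtain ⟨Λ, u, hΛs, hΛt⟩ :=
      geometric_hahn_banach_open hs_convex hs_open (convex_convexHull ℝ _) hdisj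
    have hu : 0 < u := by simpa using hΛs 0 (fun z => by simpa using hε)
    have hpos : ∀ g : C(Circle, ℝ), 0 ≤ g → Λ g ≤ 0 := by
      intro g hg
      by_contra! hlt
      obtain ⟨n, hn⟩ := exists_nat_gt (u / Λ g)
      rw [div_lt_iff₀ hlt] at hn
      have : Λ ((n : ℝ) • g) < u := hΛs _ fun z => by
        have : 0 ≤ (n : ℝ) * g z := mul_nonneg n.cast_nonneg (hg z)
        simp only [ContinuousMap.smul_apply, smul_eq_mul]
        linarith
      rw [map_smul, smul_eq_mul] at this
      linarith
    let Φ : CompactlySupportedContinuousMap Circle ℝ →ₗ[ℝ] ℝ :=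
      { toFun := fun g => -Λ g.toContinuousMap
        map_add' := fun g g' => by
          have : (g + g').toContinuousMap = g.toContinuousMap + g'.toContinuousMap := rfl
          rw [this, map_add, neg_add]
        map_smul' := fun r g => by
          have : (r • g).toContinuousMap = r • g.toContinuousMap := rfl
          rw [this, map_smul]
          simp }
    let Ψ := PositiveLinearMap.mk₀ Φ fun g hg => neg_nonneg.2 (hpos g.toContinuousMap hg)
    refine hu.not_ge (nonpos_of_integral_pow_sq_le_neg (RealRMK.rieszMeasure Ψ) ?_)
    intro k hk
    obtain ⟨k, rfl⟩ := Nat.exists_eq_add_of_le' hk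
    have := RealRMK.integral_rieszMeasure Ψ
      (CompactlySupportedContinuousMap.continuousMapEquiv (G k))
    refine (this.trans_le ?_)
    exact neg_le_neg (hΛt _ (subset_convexHull ℝ _ ⟨k, rfl⟩))
  · obtain ⟨g, hgs, hgt⟩ := Set.not_disjoint_iff.1 hdisj
    obtain ⟨ι, _, a, g', ha, ha1, hg', rfl⟩ := mem_convexHull_iff_exists_fintype.1 hgt
    choose m hm using hg'
    refine ⟨ι, inferInstance, a, fun i => m i + 1, ha, ha1, fun i => Nat.le_add_left 1 _,
      fun z => ?_⟩
    have := (hgs z).le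
    simp only [← hm, ContinuousMap.sum_apply, ContinuousMap.smul_apply, smul_eq_mul] at this
    exact this

/-- The correlation of `f` with its translate by `s`, expanded in characters of `ZMod N`. -/
lemma ZMod.sum_norm_sq_mul_stdAddChar {N : ℕ} [NeZero N] (f : ZMod N → ℝ) (s : ZMod N) :
    ∑ ξ : ZMod N, ((‖∑ n : ZMod N, (f n : ℂ) * ZMod.stdAddChar (ξ * n)‖ ^ 2 : ℝ) : ℂ) *
      ZMod.stdAddChar (ξ * s) = N * ∑ n : ZMod N, (f n : ℂ) * f (n + s) := by
  have hexp : ∀ ξ : ZMod N,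
      ((‖∑ n : ZMod N, (f n : ℂ) * ZMod.stdAddChar (ξ * n)‖ ^ 2 : ℝ) : ℂ) *
        ZMod.stdAddChar (ξ * s) =
      ∑ n : ZMod N, ∑ m : ZMod N, (f n : ℂ) * f m * ZMod.stdAddChar (ξ * (n - m + s)) := by
    intro ξ
    push_cast
    rw [← Complex.mul_conj', map_sum, Finset.sum_mul_sum, Finset.sum_mul]
    refine Finset.sum_congr rfl fun n _ => ?_
    rw [Finset.sum_mul]
    refine Finset.sum_congr rfl fun m _ => ?_
    have e : ξ * (n - m + s) = ξ * n + -(ξ * m) + ξ * s := by ring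
    rw [e, AddChar.map_add_eq_mul, AddChar.map_add_eq_mul, AddChar.map_neg_eq_conj,
      map_mul (starRingEnd ℂ), Complex.conj_ofReal]
    ring
  simp_rw [hexp]
  rw [Finset.sum_comm, Finset.mul_sum]
  refine Finset.sum_congr rfl fun n _ => ?_
  rw [Finset.sum_comm]
  simp_rw [← Finset.mul_sum, AddChar.sum_mulShift _ (ZMod.isPrimitive_stdAddChar N)]
  rw [Finset.sum_eq_single (n + s)]
  · simp [ZMod.card]
    ring
  · intro m _ hm
    have : n - m + s ≠ 0 := fun h0 => hm (by linear_combination -h0)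
    simp [this]
  · simp

/-- If the real parts of a convex combination of the characters `z ↦ z ^ k i ^ 2` are at least `-ε`,
then the corresponding combination of correlations of `f` along dilated squares is nearly
at least the square of the mean. -/
lemma ZMod.le_sum_mul_correlation {N : ℕ} [NeZero N] {ι : Type} [Fintype ι] {a : ι → ℝ} {k : ι → ℕ}
    {ε : ℝ} (hε : 0 ≤ ε) (ha : ∑ i, a i = 1)
    (hT : ∀ z : Circle, -ε ≤ ∑ i, a i * ((z ^ k i ^ 2 : Circle) : ℂ).re)
    {f : ZMod N → ℝ} (hf : ∀ x, 0 ≤ f x ∧ f x ≤ 1) (d : ℕ) :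
    (∑ x, f x) ^ 2 - ε * N ^ 2 ≤
      N * ∑ i, a i * ∑ n, f n * f (n + ((d * k i : ℕ) : ZMod N) ^ 2) := by
  set c : ZMod N → ℝ := fun ξ => ‖∑ n : ZMod N, (f n : ℂ) * ZMod.stdAddChar (ξ * n)‖ ^ 2 with hc
  have hc0 : ∀ ξ, 0 ≤ c ξ := fun ξ => by positivity
  have hcorr : ∀ s : ZMod N,
      ∑ ξ, c ξ * (ZMod.stdAddChar (ξ * s)).re = N * ∑ n, f n * f (n + s) := by
    intro s
    have := congrArg Complex.re (ZMod.sum_norm_sq_mul_stdAddChar f s)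
    rw [Complex.re_sum] at this
    simp_rw [Complex.re_ofReal_mul] at this
    rw [this]
    exact_mod_cast rfl
  have hsum : ∑ ξ, c ξ ≤ (N : ℝ) ^ 2 := by
    have := hcorr 0
    simp only [mul_zero, AddChar.map_zero_eq_one, Complex.one_re, mul_one, add_zero] at this
    rw [this, pow_two]
    gcongr
    calc ∑ n, f n * f n ≤ ∑ _n : ZMod N, (1 : ℝ) :=
          Finset.sum_le_sum fun n _ => mul_le_one₀ (hf n).2 (hf n).1 (hf n).2
      _ = N := by simp [ZMod.card]
  have hzero : c 0 = (∑ x, f x) ^ 2 := by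
    simp only [hc, zero_mul, AddChar.map_zero_eq_one, mul_one]
    rw [← Complex.ofReal_sum, Complex.norm_real, Real.norm_eq_abs, sq_abs]
  set T : ZMod N → ℝ := fun ξ =>
    ∑ i, a i * (ZMod.stdAddChar (ξ * ((d * k i : ℕ) : ZMod N) ^ 2)).re with hTdef
  have hchar : ∀ (ξ : ZMod N) (i : ι), ZMod.stdAddChar (ξ * ((d * k i : ℕ) : ZMod N) ^ 2)
      = (((ZMod.toCircle (ξ * (d : ZMod N) ^ 2)) ^ k i ^ 2 : Circle) : ℂ) := by
    intro ξ i
    rw [← AddChar.map_nsmul_eq_pow, ZMod.stdAddChar_apply]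
    congr 2
    rw [nsmul_eq_mul]
    push_cast
    ring
  have hTge : ∀ ξ, -ε ≤ T ξ := fun ξ => by
    simp only [hTdef, hchar]
    exact hT _
  have hTzero : T 0 = 1 := by simp [hTdef, ha]
  have hrhs : N * ∑ i, a i * ∑ n, f n * f (n + ((d * k i : ℕ) : ZMod N) ^ 2)
      = ∑ ξ, c ξ * T ξ := by
    simp_rw [hTdef, Finset.mul_sum (s := (Finset.univ : Finset ι))]
    rw [Finset.sum_comm]
    refine Finset.sum_congr rfl fun i _ => ?_
    rw [mul_left_comm, ← hcorr, Finset.mul_sum]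
    exact Finset.sum_congr rfl fun ξ _ => by ring
  rw [hrhs]
  have hsplit : c 0 ≤ ∑ ξ, c ξ * (T ξ + ε) := by
    calc c 0 ≤ c 0 * (T 0 + ε) := by
          rw [hTzero]
          exact le_mul_of_one_le_right (hc0 0) (by linarith)
      _ ≤ _ := Finset.single_le_sum (f := fun ξ => c ξ * (T ξ + ε))
          (fun ξ _ => mul_nonneg (hc0 ξ) (by linarith [hTge ξ])) (Finset.mem_univ 0)
  simp_rw [mul_add, Finset.sum_add_distrib, ← Finset.sum_mul] at hsplit
  have := mul_le_mul_of_nonneg_left hsum hε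
  linarith

/-- Varnavides-type theorem for square differences: for every `0 < δ ≤ 1` there are
`c(δ) > 0` and an error function `e = o_δ(1)` such that for every prime `N` and every
`f : ZMod N → [0,1]` with `E f ≥ δ`, the average of `f(n) f(n + r²)` over `n ∈ ZMod N`
and integers `1 ≤ r ≤ ⌊√(N/3)⌋` is at least `c(δ) - e(N)`. -/
theorem varnavides_square_differences (δ : ℝ) (hδ0 : 0 < δ) (hδ1 : δ ≤ 1) :
    ∃ c : ℝ, 0 < c ∧ ∃ e : ℕ → ℝ,
      Filter.Tendsto e Filter.atTop (nhds 0) ∧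
      ∀ N : ℕ, N.Prime → ∀ [NeZero N],
        ∀ f : ZMod N → ℝ, (∀ x, 0 ≤ f x ∧ f x ≤ 1) →
          δ ≤ (∑ x : ZMod N, f x) / (N : ℝ) →
          c - e N ≤
            (∑ r ∈ Finset.Icc 1 (Nat.floor (Real.sqrt ((N : ℝ) / 3))),
              ∑ n : ZMod N, f n * f (n + (r : ZMod N) ^ 2)) /
            ((N : ℝ) * (Nat.floor (Real.sqrt ((N : ℝ) / 3)) : ℝ)) := by
  obtain ⟨ι, _, a, k, ha0, ha1, hk, hT⟩ :=
    exists_square_trigonometric_combination (ε := δ ^ 2 / 2) (by positivity)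
  set K : ℕ := ∑ i, k i + 1 with hK
  have hkK : ∀ i, k i ≤ K := fun i =>
    (Finset.single_le_sum (fun _ _ => Nat.zero_le _) (Finset.mem_univ i)).trans (Nat.le_succ _)
  have hK0 : 0 < K := Nat.succ_pos _
  have hK0' : (0 : ℝ) < K := by exact_mod_cast hK0
  set R : ℕ → ℕ := fun N => Nat.floor (Real.sqrt ((N : ℝ) / 3)) with hR
  have hRtop : Filter.Tendsto R Filter.atTop Filter.atTop :=
    tendsto_nat_floor_atTop.comp (Real.tendsto_sqrt_atTop.comp
      (tendsto_natCast_atTop_atTop.atTop_div_const (by norm_num)))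
  set c : ℝ := δ ^ 2 / (4 * K) with hc
  have hc0 : 0 < c := by positivity
  refine ⟨c, hc0, fun N => if K ≤ R N then 0 else c, ?_, ?_⟩
  · refine tendsto_const_nhds.congr' ?_
    filter_upwards [hRtop.eventually_ge_atTop K] with N hN
    rw [if_pos hN]
  intro N _ _ f hf hδ
  change c - (if K ≤ R N then 0 else c) ≤
    (∑ r ∈ Finset.Icc 1 (R N), ∑ n : ZMod N, f n * f (n + (r : ZMod N) ^ 2)) / ((N : ℝ) * (R N : ℝ))
  set X : ℕ → ℝ := fun r => ∑ n : ZMod N, f n * f (n + (r : ZMod N) ^ 2) with hX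
  have hX0 : ∀ r, 0 ≤ X r := fun r =>
    Finset.sum_nonneg fun n _ => mul_nonneg (hf _).1 (hf _).1
  have hN0 : (0 : ℝ) < N := by exact_mod_cast Nat.pos_of_neZero N
  split_ifs with hKR
  · set D : ℕ := R N / K with hD
    have hdil : ∀ d : ℕ, δ ^ 2 / 2 * N ≤ ∑ i, a i * X (d * k i) := by
      intro d
      have h1 := ZMod.le_sum_mul_correlation (by positivity) ha1 hT hf d
      rw [le_div_iff₀ hN0] at hδ
      have h2 : (δ * N) ^ 2 ≤ (∑ x, f x) ^ 2 := by gcongr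
      refine le_of_mul_le_mul_left ?_ hN0
      calc N * (δ ^ 2 / 2 * N) ≤ (∑ x, f x) ^ 2 - δ ^ 2 / 2 * N ^ 2 := by linarith
        _ ≤ _ := h1
    have hsum : D * (δ ^ 2 / 2 * N) ≤ ∑ r ∈ Finset.Icc 1 (R N), X r := by
      calc D * (δ ^ 2 / 2 * N) = ∑ d ∈ Finset.Icc 1 D, δ ^ 2 / 2 * N := by simp
        _ ≤ ∑ d ∈ Finset.Icc 1 D, ∑ i, a i * X (d * k i) := Finset.sum_le_sum fun d _ => hdil d
        _ = ∑ i, a i * ∑ d ∈ Finset.Icc 1 D, X (d * k i) := by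
          rw [Finset.sum_comm]
          simp_rw [Finset.mul_sum]
        _ ≤ ∑ i, a i * ∑ r ∈ Finset.Icc 1 (R N), X r := by
          refine Finset.sum_le_sum fun i _ => mul_le_mul_of_nonneg_left ?_ (ha0 i)
          have hinj : Set.InjOn (fun d => d * k i) (Finset.Icc 1 D : Finset ℕ) :=
            fun d _ d' _ h => Nat.eq_of_mul_eq_mul_right (hk i) h
          rw [← Finset.sum_image (f := X) hinj]
          refine Finset.sum_le_sum_of_subset_of_nonneg ?_ fun r _ _ => hX0 r
          intro r hr
          obtain ⟨d, hd, rfl⟩ := Finset.mem_image.1 hr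
          rw [Finset.mem_Icc] at hd ⊢
          exact ⟨Nat.mul_pos hd.1 (hk i),
            (Nat.mul_le_mul hd.2 (hkK i)).trans (Nat.div_mul_le_self _ _)⟩
        _ = _ := by rw [← Finset.sum_mul, ha1, one_mul]
    have hRD : (R N : ℝ) ≤ 2 * K * D := by
      have h1 : 1 ≤ D := (Nat.one_le_div_iff hK0).2 hKR
      have h2 : R N < K * (D + 1) := by
        simpa [mul_comm] using Nat.lt_mul_div_succ (R N) hK0
      have h3 : R N ≤ 2 * K * D := by nlinarith
      exact_mod_cast h3
    have hR0 : (0 : ℝ) < R N := by exact_mod_cast hK0.trans_le hKR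
    rw [sub_zero, le_div_iff₀ (by positivity)]
    refine le_trans ?_ hsum
    calc c * (N * R N) ≤ c * (N * (2 * K * D)) := by gcongr
      _ = D * (δ ^ 2 / 2 * N) := by
        rw [hc]
        field_simp
        ring
  · rw [sub_self]
    exact div_nonneg (Finset.sum_nonneg fun r _ => hX0 r) (by positivity)
end

section
/- (Varnavides-type theorem for k-th power differences.) Fix an integer k ≥ 2. For every 0 < δ ≤ 1 there is a constant c(δ) > 0 and a function o_δ(1) tending to 0 as N → ∞ such that the following holds: for every prime N ≥ 1 and every function f : Z_N → [0,1] with E f ≥ δ, one has E( f(n) f(n + r^k) : n ∈ Z_N, r ∈ Z_N with 1 ≤ r ≤ ⌊(N/3)^{1/k}⌋ ) ≥ c(δ) − o_δ(1); here the expectation is the average of f(n) f(n + r^k) over all n ∈ Z_N and all integers r with 1 ≤ r ≤ ⌊(N/3)^{1/k}⌋, with n + r^k computed in Z_N. -/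
open scoped BigOperators
open Finset Filter Polynomial

section Differencing

lemma norm_sum_range_sub_sum_shift_le {E : Type*} [NormedAddCommGroup E] {v : ℕ → E}
    (hv : ∀ r, ‖v r‖ ≤ 1) (R s : ℕ) :
    ‖∑ r ∈ range R, v r - ∑ r ∈ range R, v (r + s)‖ ≤ 2 * s := by
  induction s with
  | zero => simp
  | succ s ih =>
    have h : ∑ r ∈ range R, v (r + s) - ∑ r ∈ range R, v (r + (s + 1)) = v s - v (R + s) := by
      rw [← sum_sub_distrib]
      have := sum_range_sub' (fun r => v (r + s)) R
      simp only [zero_add] at this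
      rw [← this]
      exact sum_congr rfl fun r _ => by rw [show r + (s + 1) = r + 1 + s by ring]
    have h2 : ‖v s - v (R + s)‖ ≤ 2 := (norm_sub_le _ _).trans (by linarith [hv s, hv (R + s)])
    calc _ = ‖(∑ r ∈ range R, v r - ∑ r ∈ range R, v (r + s)) + (v s - v (R + s))‖ := by
          rw [← h]; congr 1; abel
      _ ≤ 2 * s + 2 := (norm_add_le _ _).trans (add_le_add ih h2)
      _ = _ := by push_cast; ring

lemma mul_norm_sum_range_le {E : Type*} [NormedAddCommGroup E] [NormedSpace ℝ E] {v : ℕ → E}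
    (hv : ∀ r, ‖v r‖ ≤ 1) (R t l : ℕ) :
    l * ‖∑ r ∈ range R, v r‖ ≤
      2 * t * l ^ 2 + ∑ r ∈ range R, ‖∑ j ∈ range l, v (r + t * j)‖ := by
  have h : ∀ j ∈ range l, ‖∑ r ∈ range R, v r - ∑ r ∈ range R, v (r + t * j)‖ ≤ 2 * t * l := by
    intro j hj
    refine (norm_sum_range_sub_sum_shift_le hv R (t * j)).trans ?_
    have : (j : ℝ) ≤ l := by exact_mod_cast (mem_range.1 hj).le
    push_cast
    rw [← mul_assoc]
    gcongr
  have h1 : (l : ℝ) • ∑ r ∈ range R, v r =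
      ∑ j ∈ range l, (∑ r ∈ range R, v r - ∑ r ∈ range R, v (r + t * j)) +
        ∑ r ∈ range R, ∑ j ∈ range l, v (r + t * j) := by
    rw [sum_sub_distrib, sum_comm (s := range R), sub_add_cancel]
    simp [Nat.cast_smul_eq_nsmul]
  calc (l : ℝ) * ‖∑ r ∈ range R, v r‖ = ‖(l : ℝ) • ∑ r ∈ range R, v r‖ := by
        rw [norm_smul]; simp
    _ ≤ ∑ j ∈ range l, (2 * t * l : ℝ) + ∑ r ∈ range R, ‖∑ j ∈ range l, v (r + t * j)‖ := by
        rw [h1]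
        exact (norm_add_le _ _).trans (add_le_add (norm_sum_le_of_le _ h) (norm_sum_le _ _))
    _ = _ := by simp; ring

/-- The van der Corput inequality. -/
lemma norm_sum_range_le_of_inner_le {E : Type*} [NormedAddCommGroup E] [InnerProductSpace ℝ E]
    {v : ℕ → E} (hv : ∀ r, ‖v r‖ ≤ 1) (R : ℕ) {H : ℕ} (hH : 0 < H) {κ : ℝ} (hκ : 0 ≤ κ)
    (h : ∀ i ∈ range H, ∀ j ∈ range H, i ≠ j →
      ∑ r ∈ range R, inner ℝ (v (r + i)) (v (r + j)) ≤ κ * R) :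
    ‖∑ r ∈ range R, v r‖ ≤ 2 * H + R * √(1 / H + κ) := by
  have hH' : (0 : ℝ) < H := by exact_mod_cast hH
  have h1 := mul_norm_sum_range_le hv R 1 H
  simp only [one_mul] at h1
  have h2 : ∑ r ∈ range R, ‖∑ j ∈ range H, v (r + j)‖ ^ 2 ≤ R * (H + H ^ 2 * κ) := by
    calc ∑ r ∈ range R, ‖∑ j ∈ range H, v (r + j)‖ ^ 2
        = ∑ i ∈ range H, ∑ j ∈ range H, ∑ r ∈ range R, inner ℝ (v (r + i)) (v (r + j)) := by
          simp_rw [← real_inner_self_eq_norm_sq, sum_inner, inner_sum]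
          rw [sum_comm]
          exact sum_congr rfl fun i _ => sum_comm
      _ ≤ ∑ i ∈ range H, ∑ j ∈ range H, ((if i = j then (R : ℝ) else 0) + κ * R) := by
          refine sum_le_sum fun i hi => sum_le_sum fun j hj => ?_
          split_ifs with hij
          · subst hij
            have : ∑ r ∈ range R, inner ℝ (v (r + i)) (v (r + i)) ≤ ∑ r ∈ range R, (1 : ℝ) := by
              refine sum_le_sum fun r _ => ?_
              rw [real_inner_self_eq_norm_sq]
              exact pow_le_one₀ (norm_nonneg _) (hv _)
            simp only [sum_const, card_range, nsmul_eq_mul, mul_one] at this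
            have : 0 ≤ κ * R := by positivity
            linarith
          · simpa using h i hi j hj hij
      _ = R * (H + H ^ 2 * κ) := by
          simp only [sum_add_distrib, sum_ite_eq, sum_const, card_range, nsmul_eq_mul]
          rw [sum_congr rfl fun i hi => if_pos hi]
          simp; ring
  have h3 : ∑ r ∈ range R, ‖∑ j ∈ range H, v (r + j)‖ ≤ R * (H * √(1 / H + κ)) := by
    have hcs := sq_sum_le_card_mul_sum_sq (s := range R)
      (f := fun r => ‖∑ j ∈ range H, v (r + j)‖)
    rw [card_range] at hcs
    refine abs_le_of_sq_le_sq' (hcs.trans ?_) (by positivity) |>.2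
    rw [mul_pow, mul_pow, Real.sq_sqrt (by positivity)]
    calc _ ≤ (R : ℝ) * (R * (H + H ^ 2 * κ)) := by gcongr
      _ = _ := by field_simp
  refine le_of_mul_le_mul_left ?_ hH'
  push_cast at h1
  linarith

lemma Polynomial.eq_C_mul_X_add_C_of_derivative_eq_C {s : ℤ[X]} {c : ℤ}
    (h : derivative s = C c) : s = C c * X + C (s.coeff 0) := by
  have h0 : derivative (s - C c * X) = 0 := by simp [h]
  have h1 := eq_C_of_derivative_eq_zero h0
  simp only [coeff_sub, mul_coeff_zero, coeff_X_zero, mul_zero, sub_zero] at h1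
  linear_combination h1

lemma Polynomial.iterate_derivative_comp_X_add_C (p : ℤ[X]) (h : ℤ) (d : ℕ) :
    derivative^[d] (p.comp (X + C h)) = (derivative^[d] p).comp (X + C h) := by
  induction d with
  | zero => rfl
  | succ d ih => simp only [Function.iterate_succ_apply', ih, derivative_comp]; simp

variable {ι : Type*} {l : Filter ι} {V : ι → Type*} [∀ i, NormedAddCommGroup (V i)]
  [∀ i, InnerProductSpace ℝ (V i)] {w : ∀ i, ℤ → V i}

/-- Polynomial averages of a stationary family are small once all linear averages are. -/
lemma eventually_norm_sum_polynomial_le (hw : ∀ i a, ‖w i a‖ ≤ 1)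
    (hstat : ∀ i a b, inner ℝ (w i a) (w i b) = inner ℝ (w i 0) (w i (b - a)))
    (hlin : ∀ q b : ℤ, q ≠ 0 → ∀ η : ℝ, 0 < η → ∀ᶠ R : ℕ in atTop, ∀ᶠ i in l,
      ‖∑ r ∈ range R, w i (q * r + b)‖ ≤ η * R)
    (d : ℕ) (p : ℤ[X]) (c : ℤ) (hc : c ≠ 0) (hp : derivative^[d + 1] p = C c)
    (η : ℝ) (hη : 0 < η) :
    ∀ᶠ R : ℕ in atTop, ∀ᶠ i in l, ‖∑ r ∈ range R, w i (p.eval (r : ℤ))‖ ≤ η * R := by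
  induction d generalizing p c η with
  | zero =>
    rw [eq_C_mul_X_add_C_of_derivative_eq_C hp]
    simpa using hlin c (p.coeff 0) hc η hη
  | succ d ih =>
    obtain ⟨H, hH⟩ := exists_nat_gt (8 / η ^ 2)
    have hH0 : (0 : ℝ) < H := lt_trans (by positivity) hH
    have hpair : ∀ i ∈ range H, ∀ j ∈ range H, i ≠ j → ∀ᶠ R : ℕ in atTop, ∀ᶠ x in l,
        ∑ r ∈ range R, inner ℝ (w x (p.eval ((r + i : ℕ) : ℤ))) (w x (p.eval ((r + j : ℕ) : ℤ)))
          ≤ η ^ 2 / 8 * R := by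
      intro i _ j _ hij
      have hs := eq_C_mul_X_add_C_of_derivative_eq_C
        (s := derivative^[d + 1] p) (c := c) ((Function.iterate_succ_apply' _ _ _).symm.trans hp)
      filter_upwards [ih (p.comp (X + C (j : ℤ)) - p.comp (X + C (i : ℤ))) (c * (j - i))
        (mul_ne_zero hc (sub_ne_zero.2 (by exact_mod_cast hij.symm)))
        (by
          rw [iterate_derivative_sub, iterate_derivative_comp_X_add_C,
            iterate_derivative_comp_X_add_C, hs]
          simp
          ring)
        (η ^ 2 / 8) (by positivity)] with R hR
      filter_upwards [hR] with x hx
      simp_rw [hstat x (p.eval _) (p.eval _)]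
      rw [← inner_sum]
      refine (real_inner_le_norm _ _).trans ?_
      refine (mul_le_of_le_one_left (norm_nonneg _) (hw x 0)).trans ?_
      simpa using hx
    have hall : ∀ᶠ R : ℕ in atTop, ∀ᶠ x in l, ∀ i ∈ range H, ∀ j ∈ range H, i ≠ j →
        ∑ r ∈ range R, inner ℝ (w x (p.eval ((r + i : ℕ) : ℤ))) (w x (p.eval ((r + j : ℕ) : ℤ)))
          ≤ η ^ 2 / 8 * R := by
      simp_rw [eventually_all_finset, eventually_all]
      exact hpair
    filter_upwards [hall, eventually_ge_atTop ⌈4 * H / η⌉₊] with R hR hRl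
    filter_upwards [hR] with x hx
    have hvdc := norm_sum_range_le_of_inner_le (v := fun r => w x (p.eval (r : ℤ)))
      (fun r => hw x _) R (by exact_mod_cast hH0) (by positivity) hx
    have h1 : 4 * H / η ≤ R := (Nat.le_ceil _).trans (by exact_mod_cast hRl)
    have h2 : √(1 / H + η ^ 2 / 8) ≤ η / 2 := by
      refine Real.sqrt_le_iff.2 ⟨by positivity, ?_⟩
      have : 1 / (H : ℝ) ≤ η ^ 2 / 8 := by
        rw [div_lt_iff₀ (by positivity)] at hH
        rw [div_le_iff₀ hH0]
        linarith
      nlinarith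
    rw [div_le_iff₀ hη] at h1
    have h3 : (R : ℝ) * √(1 / H + η ^ 2 / 8) ≤ R * (η / 2) := by gcongr
    linarith

end Differencing

section PowerDifferenceFree

/-- `A` contains no two elements differing by a positive `k`-th power. -/
def PowerDifferenceFree (k : ℕ) (A : Finset ℕ) : Prop :=
  ∀ a ∈ A, ∀ s : ℕ, 1 ≤ s → a + s ^ k ∉ A

lemma PowerDifferenceFree.mono {k : ℕ} {A B : Finset ℕ} (hA : PowerDifferenceFree k A)
    (h : B ⊆ A) : PowerDifferenceFree k B :=
  fun a ha s hs hb => hA a (h ha) s hs (h hb)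

open scoped Classical in
/-- The largest size of a subset of `{0, …, n - 1}` without `k`-th power differences. -/
noncomputable def maxPowerDifferenceFree (k n : ℕ) : ℕ :=
  ((range n).powerset.filter (PowerDifferenceFree k)).sup card

lemma card_le_maxPowerDifferenceFree {k n : ℕ} {A : Finset ℕ} (hA : PowerDifferenceFree k A)
    (hn : A ⊆ range n) : #A ≤ maxPowerDifferenceFree k n :=
  le_sup (f := card) (by simp [hA, hn])

lemma exists_card_eq_maxPowerDifferenceFree (k n : ℕ) :
    ∃ A ⊆ range n, PowerDifferenceFree k A ∧ #A = maxPowerDifferenceFree k n := by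
  classical
  obtain ⟨A, hA, h⟩ := exists_mem_eq_sup
    ((range n).powerset.filter (PowerDifferenceFree k)) ⟨∅, by simp [PowerDifferenceFree]⟩ card
  simp only [mem_filter, mem_powerset] at hA
  exact ⟨A, hA.1, hA.2, by rw [maxPowerDifferenceFree]; convert h.symm⟩

lemma maxPowerDifferenceFree_add_le (k m n : ℕ) :
    maxPowerDifferenceFree k (m + n) ≤ maxPowerDifferenceFree k m + maxPowerDifferenceFree k n := by
  obtain ⟨A, hA, hf, h⟩ := exists_card_eq_maxPowerDifferenceFree k (m + n)
  rw [← h, ← card_filter_add_card_filter_not (s := A) (· < m)]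
  refine add_le_add (card_le_maxPowerDifferenceFree (hf.mono (filter_subset _ _)) ?_) ?_
  · intro x hx
    simpa using (mem_filter.1 hx).2
  · have hinj : Set.InjOn (fun x => x - m) ({x ∈ A | ¬ x < m} : Finset ℕ) := by
      intro x hx y hy hxy
      simp only [coe_filter, Set.mem_ofPred_eq, not_lt] at hx hy hxy
      omega
    rw [← card_image_of_injOn hinj]
    refine card_le_maxPowerDifferenceFree ?_ ?_
    · intro a ha s hs hb
      simp only [mem_image, mem_filter, not_lt] at ha hb
      obtain ⟨x, ⟨hx, hxm⟩, rfl⟩ := ha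
      obtain ⟨y, ⟨hy, hym⟩, hxy⟩ := hb
      refine hf x hx s hs ?_
      rwa [show x + s ^ k = y by omega]
    · intro a ha
      simp only [mem_image, mem_filter, not_lt] at ha
      obtain ⟨x, ⟨hx, hxm⟩, rfl⟩ := ha
      have := mem_range.1 (hA hx)
      simp only [mem_range]
      omega

lemma subadditive_maxPowerDifferenceFree (k : ℕ) :
    Subadditive fun n => (maxPowerDifferenceFree k n : ℝ) :=
  fun m n => by dsimp only; exact_mod_cast maxPowerDifferenceFree_add_le k m n

lemma bddBelow_maxPowerDifferenceFree_div (k : ℕ) :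
    BddBelow (Set.range fun n => (maxPowerDifferenceFree k n : ℝ) / n) :=
  ⟨0, by rintro _ ⟨n, rfl⟩; positivity⟩

/-- Cutting off the last `R ^ k` elements of an extremal set gives a set in a large cyclic group
without differences `r ^ k`, `1 ≤ r ≤ R`. -/
lemma exists_zmod_powerDifferenceFree {k : ℕ} {α : ℝ} {N R : ℕ} [NeZero N]
    (hα : α * N ≤ maxPowerDifferenceFree k N) :
    ∃ A : Finset (ZMod N), α * N - R ^ k ≤ #A ∧
      ∀ a ∈ A, ∀ r : ℕ, 1 ≤ r → r ≤ R → a + (r : ZMod N) ^ k ∉ A := by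
  obtain ⟨B, hB, hf, h⟩ := exists_card_eq_maxPowerDifferenceFree k N
  refine ⟨univ.filter fun x : ZMod N => x.val ∈ B ∧ x.val + R ^ k < N, ?_, ?_⟩
  · have hsub : B ⊆ ((univ.filter fun x : ZMod N => x.val ∈ B ∧ x.val + R ^ k < N).image ZMod.val)
        ∪ Ico (N - R ^ k) N := by
      intro b hb
      have hbN := mem_range.1 (hB hb)
      by_cases hbR : b + R ^ k < N
      · refine mem_union_left _ (mem_image.2 ⟨(b : ZMod N), ?_, ZMod.val_cast_of_lt hbN⟩)
        simp [ZMod.val_cast_of_lt hbN, hb, hbR]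
      · exact mem_union_right _ (mem_Ico.2 ⟨by omega, hbN⟩)
    have hcard := (card_le_card hsub).trans ((card_union_le _ _).trans
      (add_le_add card_image_le (Nat.card_Ico _ _).le))
    have : (#B : ℝ) ≤ #(univ.filter fun x : ZMod N => x.val ∈ B ∧ x.val + R ^ k < N) + R ^ k := by
      exact_mod_cast hcard.trans (by omega)
    rw [← h] at hα
    linarith
  · intro a ha r hr hrR hb
    simp only [mem_filter, mem_univ, true_and] at ha hb
    have hrk : r ^ k ≤ R ^ k := Nat.pow_le_pow_left hrR k
    have hval : (a + (r : ZMod N) ^ k).val = a.val + r ^ k := by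
      conv_lhs => rw [← ZMod.natCast_zmod_val a]
      rw [← Nat.cast_pow, ← Nat.cast_add, ZMod.val_cast_of_lt (by omega)]
    exact hf _ ha.1 r hr (hval ▸ hb.1)

lemma card_filter_progression_le {k : ℕ} (hk : k ≠ 0) {N R : ℕ} {A : Finset (ZMod N)}
    (hA : ∀ a ∈ A, ∀ r : ℕ, 1 ≤ r → r ≤ R → a + (r : ZMod N) ^ k ∉ A)
    {q l : ℕ} (hq : 1 ≤ q) (hR : q * l ≤ R) (a : ZMod N) :
    #{j ∈ range l | a + (q : ZMod N) ^ k * (j : ℕ) ∈ A} ≤ maxPowerDifferenceFree k l := by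
  refine card_le_maxPowerDifferenceFree ?_ (filter_subset _ _)
  intro j hj s hs hb
  simp only [mem_filter, mem_range] at hj hb
  have hsl : s ≤ l := by have := Nat.le_self_pow hk s; omega
  refine hA _ hj.2 (q * s) (Nat.mul_pos hq hs) ((Nat.mul_le_mul_left q hsl).trans hR) ?_
  convert hb.2 using 1
  push_cast
  ring

end PowerDifferenceFree

section CyclicTranslates

variable {N : ℕ} [NeZero N]

/-- The translate `n ↦ g (n + a)`, as a vector of the normalized `L²` space on `ZMod N`. -/
noncomputable def zmodTranslate (g : ZMod N → ℝ) (a : ℤ) : EuclideanSpace ℝ (ZMod N) :=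
  WithLp.toLp 2 fun n => g (n + a) / √N

lemma inner_zmodTranslate (g : ZMod N → ℝ) (a b : ℤ) :
    inner ℝ (zmodTranslate g a) (zmodTranslate g b) = (∑ n, g (n + a) * g (n + b)) / N := by
  rw [PiLp.inner_apply, sum_div]
  refine sum_congr rfl fun n _ => ?_
  have : (√N : ℝ) * √N = N := Real.mul_self_sqrt (Nat.cast_nonneg N)
  simp only [zmodTranslate, RCLike.inner_apply, conj_trivial]
  rw [div_mul_div_comm, this, mul_comm]

lemma inner_zmodTranslate_eq (g : ZMod N → ℝ) (a b : ℤ) :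
    inner ℝ (zmodTranslate g a) (zmodTranslate g b) =
      inner ℝ (zmodTranslate g 0) (zmodTranslate g (b - a)) := by
  rw [inner_zmodTranslate, inner_zmodTranslate]
  congr 1
  rw [← Equiv.sum_comp (Equiv.addRight (a : ZMod N)) fun n => g (n + (0 : ℤ)) * g (n + (b - a : ℤ))]
  refine sum_congr rfl fun n _ => ?_
  simp

lemma norm_zmodTranslate_le {g : ZMod N → ℝ} (hg : ∀ n, |g n| ≤ 1) (a : ℤ) :
    ‖zmodTranslate g a‖ ≤ 1 := by
  have h : ‖zmodTranslate g a‖ ^ 2 ≤ 1 ^ 2 := by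
    rw [← real_inner_self_eq_norm_sq, inner_zmodTranslate]
    refine div_le_of_le_mul₀ (by positivity) (by positivity) ?_
    calc ∑ n : ZMod N, g (n + a) * g (n + a) ≤ ∑ n : ZMod N, (1 : ℝ) :=
          sum_le_sum fun n _ => by
            rw [← pow_two, ← sq_abs]
            exact pow_le_one₀ (abs_nonneg _) (hg _)
      _ = _ := by simp [ZMod.card]
  exact abs_le_of_sq_le_sq' h zero_le_one |>.2

lemma norm_sum_zmodTranslate_sq {J : Type*} (s : Finset J) (g : ZMod N → ℝ) (u : J → ℤ) :
    ‖∑ j ∈ s, zmodTranslate g (u j)‖ ^ 2 = (∑ n, (∑ j ∈ s, g (n + u j)) ^ 2) / N := by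
  rw [← real_inner_self_eq_norm_sq]
  simp_rw [sum_inner, inner_sum, inner_zmodTranslate, pow_two, sum_mul_sum, ← sum_div]
  congr 1
  rw [sum_comm (s := univ)]
  exact sum_congr rfl fun i _ => sum_comm

lemma abs_sub_average_le_one {f : ZMod N → ℝ} (hf : ∀ n, 0 ≤ f n ∧ f n ≤ 1) (n : ZMod N) :
    |f n - (∑ x, f x) / N| ≤ 1 := by
  have hN : (0 : ℝ) < N := by exact_mod_cast Nat.pos_of_ne_zero (NeZero.ne N)
  have h1 : 0 ≤ (∑ x, f x) / N := div_nonneg (sum_nonneg fun x _ => (hf x).1) hN.le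
  have h2 : (∑ x, f x) / N ≤ 1 := by
    rw [div_le_one hN]
    calc ∑ x, f x ≤ ∑ x : ZMod N, (1 : ℝ) := sum_le_sum fun x _ => (hf x).2
      _ = N := by simp [ZMod.card]
  rw [abs_le]
  constructor <;> linarith [(hf n).1, (hf n).2]

lemma sum_sub_average (f : ZMod N → ℝ) : ∑ n, (f n - (∑ x, f x) / N) = 0 := by
  have hN : (N : ℝ) ≠ 0 := by exact_mod_cast NeZero.ne N
  rw [sum_sub_distrib]
  simp [ZMod.card, mul_div_cancel₀ _ hN]

/-- If no translate of a progression carries more than the average density plus `ε`, then the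
averages of the balanced function along the progression are small in `L²`. -/
lemma norm_sum_zmodTranslate_progression_sq_le {f : ZMod N → ℝ} (hf : ∀ n, 0 ≤ f n ∧ f n ≤ 1)
    {ε : ℝ} (hε : 0 ≤ ε) {l : ℕ} {m : ℤ}
    (h : ∀ a : ZMod N, ∑ j ∈ range l, f (a + m * j) ≤ ((∑ x, f x) / N + ε) * l) (b : ℤ) :
    ‖∑ j ∈ range l, zmodTranslate (fun n => f n - (∑ x, f x) / N) (b + m * j)‖ ^ 2 ≤
      2 * ε * l ^ 2 := by
  have hN : (0 : ℝ) < N := by exact_mod_cast Nat.pos_of_ne_zero (NeZero.ne N)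
  have hs := sum_sub_average f
  have ha := abs_sub_average_le_one hf
  set g : ZMod N → ℝ := fun n => f n - (∑ x, f x) / N with hg
  rw [norm_sum_zmodTranslate_sq, div_le_iff₀ hN]
  set T : ZMod N → ℝ := fun n => ∑ j ∈ range l, g (n + (b + m * j : ℤ)) with hT
  have hT0 : ∑ n, T n = 0 := by
    rw [hT, sum_comm]
    refine sum_eq_zero fun j _ => ?_
    rw [← hs]
    exact Equiv.sum_comp (Equiv.addRight ((b + m * j : ℤ) : ZMod N)) g
  have hT1 : ∀ n, |T n| ≤ l := fun n =>
    (abs_sum_le_sum_abs _ _).trans ((sum_le_sum fun j _ => ha _).trans (by simp))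
  have hT2 : ∀ n, T n ≤ ε * l := by
    intro n
    have := h (n + b)
    simp only [hT, hg, sum_sub_distrib, sum_const, card_range, nsmul_eq_mul]
    push_cast
    simp_rw [← add_assoc]
    linarith
  calc ∑ n, T n ^ 2 ≤ ∑ n, l * (2 * (ε * l) - T n) := by
        refine sum_le_sum fun n _ => ?_
        have hle : |T n| ≤ 2 * (ε * l) - T n := by
          have : 0 ≤ ε * l := by positivity
          exact abs_le.2 ⟨by linarith, by linarith [hT2 n]⟩
        rw [← sq_abs, pow_two]
        exact mul_le_mul (hT1 n) hle (abs_nonneg _) (by positivity)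
    _ = _ := by
        rw [← mul_sum, sum_sub_distrib, hT0]
        simp [ZMod.card]
        ring

end CyclicTranslates

section PowerDifferenceFree

lemma sum_indicator_progression_le {k : ℕ} (hk : k ≠ 0) {N R : ℕ} {A : Finset (ZMod N)}
    (hA : ∀ a ∈ A, ∀ r : ℕ, 1 ≤ r → r ≤ R → a + (r : ZMod N) ^ k ∉ A)
    {q l : ℕ} (hq : 1 ≤ q) (hR : q * l ≤ R) {m : ℤ} (hm : m = q ^ k ∨ m = -q ^ k) (a : ZMod N) :
    ∑ j ∈ range l, (if a + m * (j : ZMod N) ∈ A then (1 : ℝ) else 0) ≤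
      maxPowerDifferenceFree k l := by
  have key : ∀ a : ZMod N,
      ∑ j ∈ range l, (if a + (q : ZMod N) ^ k * (j : ZMod N) ∈ A then (1 : ℝ) else 0) ≤
      maxPowerDifferenceFree k l := by
    intro a
    rw [sum_boole]
    exact_mod_cast card_filter_progression_le hk hA hq hR a
  rcases hm with rfl | rfl
  · simpa using key a
  · rw [← sum_range_reflect]
    refine le_of_eq_of_le (sum_congr rfl fun j hj => ?_) (key (a - q ^ k * (l - 1 : ℕ)))
    have hj' : j ≤ l - 1 := by have := mem_range.1 hj; omega
    have : a + ((-(q : ℤ) ^ k : ℤ) : ZMod N) * ((l - 1 - j : ℕ) : ZMod N) =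
        a - q ^ k * (l - 1 : ℕ) + (q : ZMod N) ^ k * j := by
      rw [Nat.cast_sub hj']
      push_cast
      ring
    rw [this]

lemma lim_maxPowerDifferenceFree_le_zero {k : ℕ} (hk : k ≠ 0) :
    (subadditive_maxPowerDifferenceFree k).lim ≤ 0 := by
  by_contra! hpos
  set α := (subadditive_maxPowerDifferenceFree k).lim with hα
  have hlim := (subadditive_maxPowerDifferenceFree k).tendsto_lim
    (bddBelow_maxPowerDifferenceFree_div k)
  rw [← hα] at hlim
  let N : ℕ → ℕ := fun i => (i + 1) ^ (k + 1)
  have hN0 : ∀ i, NeZero (N i) := fun i => ⟨by positivity⟩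
  have hNpos : ∀ i, (0 : ℝ) < N i := fun i => by simp only [N]; positivity
  have hex : ∀ i, ∃ A : Finset (ZMod (N i)), α * N i - i ^ k ≤ #A ∧
      ∀ a ∈ A, ∀ r : ℕ, 1 ≤ r → r ≤ i → a + (r : ZMod (N i)) ^ k ∉ A := by
    intro i
    refine exists_zmod_powerDifferenceFree ?_
    rw [← le_div_iff₀ (hNpos i)]
    exact (subadditive_maxPowerDifferenceFree k).lim_le_div
      (bddBelow_maxPowerDifferenceFree_div k) (NeZero.ne (N i))
  choose A hAcard hA using hex
  let f : ∀ i, ZMod (N i) → ℝ := fun i n => if n ∈ A i then 1 else 0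
  have hf : ∀ i n, 0 ≤ f i n ∧ f i n ≤ 1 := fun i n => by
    simp only [f]; split_ifs <;> norm_num
  let β : ℕ → ℝ := fun i => (∑ x, f i x) / N i
  have hβ : ∀ i : ℕ, α - 1 / (i + 1) ≤ β i := by
    intro i
    simp only [β]
    rw [le_div_iff₀ (hNpos i)]
    have h1 : ∑ x, f i x = #(A i) := by simp [f]
    rw [h1]
    refine le_trans ?_ (hAcard i)
    rw [sub_mul]
    have h2 : 1 / ((i : ℝ) + 1) * N i = (i + 1) ^ k := by
      simp only [N]
      push_cast
      rw [pow_succ]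
      field_simp
    rw [h2]
    gcongr
    linarith
  have hβev : ∀ ε : ℝ, 0 < ε → ∀ᶠ i in atTop, α - ε ≤ β i := by
    intro ε hε
    filter_upwards [(tendsto_one_div_add_atTop_nhds_zero_nat (𝕜 := ℝ)).eventually_lt_const hε]
      with i hi
    linarith [hβ i]
  let w : ∀ i, ℤ → EuclideanSpace ℝ (ZMod (N i)) := fun i => zmodTranslate fun n => f i n - β i
  have hw : ∀ i a, ‖w i a‖ ≤ 1 := fun i a =>
    norm_zmodTranslate_le (abs_sub_average_le_one (hf i)) a
  have hlin : ∀ q b : ℤ, q ≠ 0 → ∀ η : ℝ, 0 < η → ∀ᶠ R : ℕ in atTop, ∀ᶠ i in atTop,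
      ‖∑ r ∈ range R, w i (q * r + b)‖ ≤ η * R := by
    intro q b hq η hη
    obtain ⟨l, hl, hl0⟩ := ((hlim.eventually_lt_const
      (show α < α + η ^ 2 / 16 by have := pow_pos hη 2; linarith)).and
        (eventually_gt_atTop 0)).exists
    have hl' : (0 : ℝ) < l := by exact_mod_cast hl0
    rw [div_lt_iff₀ hl'] at hl
    set t := q.natAbs ^ (k - 1) with ht
    have hm : q * t = (q.natAbs : ℤ) ^ k ∨ q * t = -(q.natAbs : ℤ) ^ k := by
      obtain ⟨k, rfl⟩ := Nat.exists_eq_succ_of_ne_zero hk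
      rcases Int.natAbs_eq q with h | h
      · left; conv_lhs => rw [h]
        simp [ht, pow_succ']
      · right; conv_lhs => rw [h]
        simp [ht, pow_succ']
    filter_upwards [eventually_ge_atTop ⌈4 * t * l / η⌉₊] with R hR
    have hR' : 4 * t * l / η ≤ R := (Nat.le_ceil _).trans (by exact_mod_cast hR)
    rw [div_le_iff₀ hη] at hR'
    filter_upwards [hβev (η ^ 2 / 16) (by positivity), eventually_ge_atTop (q.natAbs * l)]
      with i hi hil
    have hprog : ∀ c : ℤ, ‖∑ j ∈ range l, w i (c + (q * t : ℤ) * j)‖ ≤ η / 2 * l := by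
      intro c
      have := norm_sum_zmodTranslate_progression_sq_le (hf i) (ε := η ^ 2 / 8) (by positivity)
        (l := l) (m := q * t) (fun a => by
          refine (sum_indicator_progression_le hk (hA i)
            (Int.natAbs_pos.2 hq) hil hm a).trans (hl.le.trans ?_)
          refine mul_le_mul_of_nonneg_right ?_ hl'.le
          change α + η ^ 2 / 16 ≤ β i + η ^ 2 / 8
          linarith) c
      refine (abs_le_of_sq_le_sq' (this.trans_eq ?_) (by positivity)).2
      ring
    have hsum := mul_norm_sum_range_le (v := fun r => w i (q * r + b)) (fun r => hw i _) R t l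
    have hsum2 : ∑ r ∈ range R, ‖∑ j ∈ range l, w i (q * ((r + t * j : ℕ) : ℤ) + b)‖ ≤
        R * (η / 2 * l) := by
      refine (sum_le_card_nsmul _ _ (η / 2 * l) fun r _ => ?_).trans_eq (by simp)
      refine le_of_eq_of_le ?_ (hprog (q * r + b))
      congr 1
      refine sum_congr rfl fun j _ => ?_
      congr 1
      push_cast
      ring
    refine le_of_mul_le_mul_left ?_ hl'
    nlinarith
  have hpow : derivative^[k - 1 + 1] ((X + 1 : ℤ[X]) ^ k) = C (k.factorial : ℤ) := by
    rw [Nat.sub_add_cancel (Nat.pos_of_ne_zero hk), ← C_1, iterate_derivative_X_add_pow]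
    simp [Nat.descFactorial_self]
  obtain ⟨R, hR, hR0⟩ := ((eventually_norm_sum_polynomial_le hw
    (fun i a b => inner_zmodTranslate_eq _ a b) hlin (k - 1) _ _
    (by exact_mod_cast k.factorial_ne_zero) hpow (α ^ 2 / 8) (by positivity)).and
      (eventually_gt_atTop 0)).exists
  obtain ⟨i, ⟨hi, hβi⟩, hiR⟩ := ((hR.and (hβev (α / 2) (by positivity))).and
    (eventually_ge_atTop R)).exists
  have hRpos : (0 : ℝ) < R := by exact_mod_cast hR0
  have hcorr : ∀ r ∈ range R, inner ℝ (w i 0) (w i (((X + 1 : ℤ[X]) ^ k).eval (r : ℤ))) =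
      -β i ^ 2 := by
    intro r hr
    simp only [w]
    rw [inner_zmodTranslate, div_eq_iff (hNpos i).ne']
    have hs := sum_sub_average (f i)
    have hz : ∀ n, f i n * f i (n + ((((r : ℤ) + 1) ^ k : ℤ) : ZMod (N i))) = 0 := by
      intro n
      simp only [f]
      split_ifs with h1 h2
      · have := hA i n h1 (r + 1) (by omega) (by have := mem_range.1 hr; omega)
        push_cast at this h2
        exact absurd h2 this
      all_goals simp
    have h1 : ∑ x, f i x = β i * N i := (div_mul_cancel₀ _ (hNpos i).ne').symm
    have h2 : ∑ x, f i (x + ((((r : ℤ) + 1) ^ k : ℤ) : ZMod (N i))) = β i * N i := by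
      rw [← h1]
      exact Equiv.sum_comp (Equiv.addRight ((((r : ℤ) + 1) ^ k : ℤ) : ZMod (N i))) (f i)
    simp only [eval_pow, eval_add, eval_X, eval_one, Int.cast_zero, add_zero]
    simp_rw [sub_mul, mul_sub, hz, sum_sub_distrib, ← mul_sum, ← sum_mul]
    rw [h1, h2]
    simp [ZMod.card]
    ring
  have hfin : R * β i ^ 2 ≤ α ^ 2 / 8 * R := by
    calc R * β i ^ 2 = -inner ℝ (w i 0)
          (∑ r ∈ range R, w i (((X + 1 : ℤ[X]) ^ k).eval (r : ℤ))) := by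
          rw [inner_sum, sum_congr rfl hcorr]; simp
      _ ≤ ‖w i 0‖ * ‖∑ r ∈ range R, w i (((X + 1 : ℤ[X]) ^ k).eval (r : ℤ))‖ :=
          (neg_le_abs _).trans (abs_real_inner_le_norm _ _)
      _ ≤ _ := (mul_le_of_le_one_left (norm_nonneg _) (hw i 0)).trans hi
  have hsq : (α / 2) ^ 2 ≤ β i ^ 2 := by
    refine pow_le_pow_left₀ (by positivity) ?_ 2
    linarith
  nlinarith [mul_le_mul_of_nonneg_left hsq hRpos.le, mul_pos hRpos (pow_pos hpos 2)]

/-- The Furstenberg–Sárközy theorem for `k`-th powers. -/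
theorem exists_maxPowerDifferenceFree_lt {k : ℕ} (hk : k ≠ 0) {δ : ℝ} (hδ : 0 < δ) :
    ∃ L : ℕ, 0 < L ∧ (maxPowerDifferenceFree k L : ℝ) < δ * L := by
  have hlim := (subadditive_maxPowerDifferenceFree k).tendsto_lim
    (bddBelow_maxPowerDifferenceFree_div k)
  obtain ⟨L, hL, hL0⟩ := ((hlim.eventually_lt_const
    ((lim_maxPowerDifferenceFree_le_zero hk).trans_lt hδ)).and (eventually_gt_atTop 0)).exists
  exact ⟨L, hL0, by rwa [div_lt_iff₀ (by exact_mod_cast hL0)] at hL⟩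

end PowerDifferenceFree

section Varnavides

lemma sum_mul_progression_ge {k : ℕ} (hk : k ≠ 0) {δ : ℝ} (hδ : 0 < δ) {L : ℕ} (hL : 0 < L)
    (hM : (maxPowerDifferenceFree k L : ℝ) < δ / 4 * L) {N : ℕ} {f : ZMod N → ℝ}
    (hf : ∀ x, 0 ≤ f x ∧ f x ≤ 1) (a : ZMod N) (d : ℕ) :
    (δ / 2) ^ 2 * ((∑ j ∈ range L, f (a + d ^ k * j)) / L - 3 * δ / 4) ≤
      ∑ j ∈ range L, ∑ s ∈ Icc 1 L,
        f (a + d ^ k * j) * f (a + d ^ k * j + ((d * s : ℕ) : ZMod N) ^ k) := by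
  classical
  have hL' : (0 : ℝ) < L := by exact_mod_cast hL
  have hnn : ∀ x y, 0 ≤ f x * f y := fun x y => mul_nonneg (hf x).1 (hf y).1
  have hsum1 : (∑ j ∈ range L, f (a + d ^ k * j)) ≤ L :=
    (sum_le_sum fun j _ => (hf _).2).trans (by simp)
  set B : Finset ℕ := {j ∈ range L | δ / 2 ≤ f (a + d ^ k * j)} with hB
  by_cases hfree : PowerDifferenceFree k B
  · have hcard : (#B : ℝ) ≤ maxPowerDifferenceFree k L := by
      exact_mod_cast card_le_maxPowerDifferenceFree hfree (filter_subset _ _)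
    have hsum : ∑ j ∈ range L, f (a + d ^ k * j) ≤ #B + δ / 2 * L := by
      calc ∑ j ∈ range L, f (a + d ^ k * j)
          ≤ ∑ j ∈ range L, ((if δ / 2 ≤ f (a + d ^ k * j) then 1 else 0) + δ / 2) := by
            refine sum_le_sum fun j _ => ?_
            split_ifs with h
            · linarith [(hf (a + d ^ k * j)).2]
            · linarith
        _ = _ := by rw [sum_add_distrib, sum_boole]; simp [hB, mul_comm]
    have h1 : (∑ j ∈ range L, f (a + d ^ k * j)) / L ≤ 3 * δ / 4 := by
      rw [div_le_iff₀ hL']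
      linarith
    refine (mul_nonpos_of_nonneg_of_nonpos (by positivity) (sub_nonpos.2 h1)).trans ?_
    exact sum_nonneg fun j _ => sum_nonneg fun s _ => hnn _ _
  · simp only [PowerDifferenceFree, not_forall, not_not] at hfree
    obtain ⟨j, hj, s, hs, hjs⟩ := hfree
    simp only [hB, mem_filter, mem_range] at hj hjs
    have hsL : s ∈ Icc 1 L := mem_Icc.2 ⟨hs, by have := Nat.le_self_pow hk s; omega⟩
    have hle : (∑ j ∈ range L, f (a + d ^ k * j)) / L ≤ 1 := (div_le_one hL').2 hsum1
    calc _ ≤ (δ / 2) ^ 2 * 1 := by gcongr; linarith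
      _ = δ / 2 * (δ / 2) := by ring
      _ ≤ f (a + d ^ k * j) * f (a + d ^ k * j + ((d * s : ℕ) : ZMod N) ^ k) := by
          refine mul_le_mul hj.2 (hjs.2.trans_eq ?_) (by positivity) (hf _).1
          congr 1
          push_cast
          ring
      _ ≤ ∑ s ∈ Icc 1 L, f (a + d ^ k * j) * f (a + d ^ k * j + ((d * s : ℕ) : ZMod N) ^ k) :=
          single_le_sum (f := fun s =>
            f (a + d ^ k * j) * f (a + d ^ k * j + ((d * s : ℕ) : ZMod N) ^ k))
            (fun s _ => hnn _ _) hsL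
      _ ≤ _ := single_le_sum (f := fun j : ℕ => ∑ s ∈ Icc 1 L,
            f (a + d ^ k * j) * f (a + d ^ k * j + ((d * s : ℕ) : ZMod N) ^ k))
            (fun j _ => sum_nonneg fun s _ => hnn _ _) (mem_range.2 hj.1)

lemma exists_forall_le_sum_mul_pow_shift {k : ℕ} (hk : k ≠ 0) {δ : ℝ} (hδ : 0 < δ) :
    ∃ c : ℝ, 0 < c ∧ ∃ R₀ : ℕ, 0 < R₀ ∧ ∀ R ≥ R₀, ∀ N : ℕ, ∀ [NeZero N], ∀ f : ZMod N → ℝ,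
      (∀ x, 0 ≤ f x ∧ f x ≤ 1) → δ ≤ (∑ x, f x) / N →
        c * (N * R) ≤ ∑ r ∈ Icc 1 R, ∑ n, f n * f (n + (r : ZMod N) ^ k) := by
  obtain ⟨L, hL, hM⟩ := exists_maxPowerDifferenceFree_lt hk (show 0 < δ / 4 by positivity)
  have hL' : (0 : ℝ) < L := by exact_mod_cast hL
  refine ⟨δ ^ 3 / (32 * L ^ 3), by positivity, L, hL, fun R hR N _ f hf hδf => ?_⟩
  have hN : (0 : ℝ) < N := by exact_mod_cast Nat.pos_of_ne_zero (NeZero.ne N)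
  rw [le_div_iff₀ hN] at hδf
  set Φ : ℕ → ℝ := fun r => ∑ n, f n * f (n + (r : ZMod N) ^ k) with hΦ
  have hΦ0 : ∀ r, 0 ≤ Φ r := fun r => sum_nonneg fun n _ => mul_nonneg (hf _).1 (hf _).1
  have hd : ∀ d : ℕ, δ ^ 3 / 16 * N ≤ L * ∑ s ∈ Icc 1 L, Φ (d * s) := by
    intro d
    have h := sum_le_sum fun a (_ : a ∈ univ) => sum_mul_progression_ge hk hδ hL hM hf a d
    have hl : ∑ a : ZMod N, (δ / 2) ^ 2 * ((∑ j ∈ range L, f (a + d ^ k * j)) / L - 3 * δ / 4) =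
        (δ / 2) ^ 2 * (∑ x, f x - 3 * δ / 4 * N) := by
      have : ∑ a : ZMod N, ∑ j ∈ range L, f (a + d ^ k * j) = L * ∑ x, f x := by
        have hshift : ∀ j ∈ range L, ∑ a : ZMod N, f (a + d ^ k * j) = ∑ x, f x := fun j _ =>
          Equiv.sum_comp (Equiv.addRight ((d : ZMod N) ^ k * j)) f
        rw [sum_comm, sum_congr rfl hshift]
        simp
      rw [← mul_sum, sum_sub_distrib, ← sum_div, this,
        mul_div_cancel_left₀ _ hL'.ne']
      simp [ZMod.card, mul_comm]
    have hr : ∑ a : ZMod N, ∑ j ∈ range L, ∑ s ∈ Icc 1 L,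
        f (a + d ^ k * j) * f (a + d ^ k * j + ((d * s : ℕ) : ZMod N) ^ k) =
        L * ∑ s ∈ Icc 1 L, Φ (d * s) := by
      have : ∀ j ∈ range L, ∑ a : ZMod N, ∑ s ∈ Icc 1 L,
          f (a + d ^ k * j) * f (a + d ^ k * j + ((d * s : ℕ) : ZMod N) ^ k) =
          ∑ s ∈ Icc 1 L, Φ (d * s) := by
        intro j _
        rw [sum_comm]
        exact sum_congr rfl fun s _ => Equiv.sum_comp (Equiv.addRight ((d : ZMod N) ^ k * j))
          fun n => f n * f (n + ((d * s : ℕ) : ZMod N) ^ k)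
      rw [sum_comm, sum_congr rfl this]
      simp
    rw [hl, hr] at h
    refine le_trans ?_ h
    nlinarith [mul_le_mul_of_nonneg_left hδf (sq_nonneg (δ / 2))]
  have hs : ∀ s ∈ Icc 1 L, ∑ d ∈ Icc 1 (R / L), Φ (d * s) ≤ ∑ r ∈ Icc 1 R, Φ r := by
    intro s hs
    have hs' := mem_Icc.1 hs
    have hinj : Set.InjOn (fun d => d * s) (Icc 1 (R / L) : Finset ℕ) := fun x _ y _ h =>
      Nat.eq_of_mul_eq_mul_right (by omega) h
    rw [← sum_image (f := Φ) hinj]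
    refine sum_le_sum_of_subset_of_nonneg ?_ fun r _ _ => hΦ0 r
    intro r hr
    obtain ⟨d, hd, rfl⟩ := mem_image.1 hr
    have hd' := mem_Icc.1 hd
    refine mem_Icc.2 ⟨Nat.mul_pos hd'.1 hs'.1, ?_⟩
    exact (Nat.mul_le_mul hd'.2 hs'.2).trans (Nat.div_mul_le_self R L)
  have htot : (R / L : ℕ) * (δ ^ 3 / 16 * N) ≤ L * (L * ∑ r ∈ Icc 1 R, Φ r) := by
    calc _ = ∑ d ∈ Icc 1 (R / L), δ ^ 3 / 16 * N := by simp
      _ ≤ ∑ d ∈ Icc 1 (R / L), L * ∑ s ∈ Icc 1 L, Φ (d * s) := sum_le_sum fun d _ => hd d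
      _ = L * ∑ s ∈ Icc 1 L, ∑ d ∈ Icc 1 (R / L), Φ (d * s) := by rw [← mul_sum, sum_comm]
      _ ≤ L * ∑ s ∈ Icc 1 L, ∑ r ∈ Icc 1 R, Φ r := by gcongr with s h; exact hs s h
      _ = _ := by simp
  have hdiv : (R : ℝ) ≤ 2 * L * (R / L : ℕ) := by
    have h1 : 1 ≤ R / L := (Nat.one_le_div_iff hL).2 hR
    have h2 := Nat.div_add_mod R L
    have h3 := Nat.mod_lt R hL
    have h4 : L ≤ L * (R / L) := Nat.le_mul_of_pos_right L h1
    have : R ≤ 2 * (L * (R / L)) := by omega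
    rw [mul_assoc]
    exact_mod_cast this
  calc δ ^ 3 / (32 * L ^ 3) * (N * R)
      ≤ δ ^ 3 / (32 * L ^ 3) * (N * (2 * L * (R / L : ℕ))) := by gcongr
    _ = (R / L : ℕ) * (δ ^ 3 / 16 * N) / L ^ 2 := by field_simp; ring
    _ ≤ L * (L * ∑ r ∈ Icc 1 R, Φ r) / L ^ 2 := by gcongr
    _ = _ := by field_simp

end Varnavides

/-- Varnavides-type theorem for `k`-th power differences: fix `k ≥ 2`; for every
`0 < δ ≤ 1` there are `c(δ) > 0` and an error function `e = o_δ(1)` such that for every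
prime `N` and every `f : ZMod N → [0,1]` with `E f ≥ δ`, the average of `f(n) f(n + rᵏ)`
over `n ∈ ZMod N` and integers `1 ≤ r ≤ ⌊(N/3)^{1/k}⌋` is at least `c(δ) - e(N)`. -/
theorem varnavides_power_differences (k : ℕ) (hk : 2 ≤ k)
    (δ : ℝ) (hδ0 : 0 < δ) (hδ1 : δ ≤ 1) :
    ∃ c : ℝ, 0 < c ∧ ∃ e : ℕ → ℝ,
      Filter.Tendsto e Filter.atTop (nhds 0) ∧
      ∀ N : ℕ, N.Prime → ∀ [NeZero N],
        ∀ f : ZMod N → ℝ, (∀ x, 0 ≤ f x ∧ f x ≤ 1) →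
          δ ≤ (∑ x : ZMod N, f x) / (N : ℝ) →
          c - e N ≤
            (∑ r ∈ Finset.Icc 1 (Nat.floor (((N : ℝ) / 3) ^ ((1 : ℝ) / k))),
              ∑ n : ZMod N, f n * f (n + (r : ZMod N) ^ k)) /
            ((N : ℝ) * (Nat.floor (((N : ℝ) / 3) ^ ((1 : ℝ) / k)) : ℝ)) := by
  obtain ⟨c, hc, R₀, hR₀, h⟩ := exists_forall_le_sum_mul_pow_shift (k := k) (by omega) hδ0
  have hlim : Tendsto (fun N : ℕ => ⌊((N : ℝ) / 3) ^ ((1 : ℝ) / k)⌋₊) atTop atTop :=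
    tendsto_nat_floor_atTop.comp ((tendsto_rpow_atTop (by positivity)).comp
      (tendsto_natCast_atTop_atTop.atTop_div_const (by norm_num)))
  refine ⟨c, hc, fun N => if R₀ ≤ ⌊((N : ℝ) / 3) ^ ((1 : ℝ) / k)⌋₊ then 0 else c, ?_, ?_⟩
  · refine tendsto_const_nhds.congr' ?_
    filter_upwards [hlim.eventually_ge_atTop R₀] with N hN
    rw [if_pos hN]
  · intro N _ _ f hf hδf
    have hN : (0 : ℝ) < N := by exact_mod_cast Nat.pos_of_ne_zero (NeZero.ne N)
    dsimp only
    split_ifs with hR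
    · have hR' : (0 : ℝ) < ⌊((N : ℝ) / 3) ^ ((1 : ℝ) / k)⌋₊ := by exact_mod_cast hR₀.trans_le hR
      rw [sub_zero, le_div_iff₀ (by positivity)]
      exact h _ hR N f hf hδf
    · rw [sub_self]
      exact div_nonneg (sum_nonneg fun r _ => sum_nonneg fun n _ =>
        mul_nonneg (hf _).1 (hf _).1) (by positivity)
end

section
/- Let N be prime, let δ ∈ (0,1], let A ⊆ {1,…,N} ⊆ Z_N with |A| ≥ δN, let k > 8 be an integer, and let r be a positive integer with r² < δN/k². For x ∈ {1,…,N}, call the arithmetic progression P_{x,r} = {x, x + r², …, x + (k−1)r²} (with 1 ≤ x and x + (k−1)r² ≤ N, all computed in the integers) 'good' if |P_{x,r} ∩ A| ≥ δk/2. Then the number of values of x for which P_{x,r} is good is strictly greater than δN/4. -/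
open scoped Classical BigOperators

/-- All but at most `2D` elements of `A ⊆ {1,…,N}` are of the form `x + e` with `x ≥ 1` and
`x + D ≤ N`, provided `e ≤ D`. -/
theorem card_le_card_shift_add {N D e : ℕ} {A : Finset ℕ} (hA : A ⊆ Finset.Icc 1 N)
    (he : e ≤ D) :
    A.card ≤ (((Finset.Icc 1 N).filter (fun x => x + D ≤ N)).filter
      (fun x => x + e ∈ A)).card + 2 * D := by
  have hsub : A ⊆ ((((Finset.Icc 1 N).filter (fun x => x + D ≤ N)).filter
      (fun x => x + e ∈ A)).image (fun x => x + e)) ∪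
        (Finset.Icc 1 D ∪ Finset.Ioc (N - D) N) := by
    intro a ha
    have h := Finset.mem_Icc.1 (hA ha)
    by_cases h1 : a ≤ D
    · exact Finset.mem_union_right _ (Finset.mem_union_left _ (Finset.mem_Icc.2 ⟨h.1, h1⟩))
    by_cases h2 : N - D < a
    · exact Finset.mem_union_right _ (Finset.mem_union_right _ (Finset.mem_Ioc.2 ⟨h2, h.2⟩))
    refine Finset.mem_union_left _ (Finset.mem_image.2 ⟨a - e, ?_, by omega⟩)
    have h3 : a - e + e = a := by omega
    simp only [Finset.mem_filter, Finset.mem_Icc, h3]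
    exact ⟨⟨⟨by omega, by omega⟩, by omega⟩, ha⟩
  have h1 := Finset.card_le_card hsub
  have h2 := Finset.card_union_le ((((Finset.Icc 1 N).filter (fun x => x + D ≤ N)).filter
      (fun x => x + e ∈ A)).image (fun x => x + e)) (Finset.Icc 1 D ∪ Finset.Ioc (N - D) N)
  have h3 := Finset.card_union_le (Finset.Icc 1 D) (Finset.Ioc (N - D) N)
  have h4 := Finset.card_image_le (s := ((Finset.Icc 1 N).filter (fun x => x + D ≤ N)).filter
      (fun x => x + e ∈ A)) (f := fun x => x + e)
  rw [Nat.card_Icc, Nat.card_Ioc] at h3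
  omega

/-- A progression of length `k` with positive difference `d` meets `A` in as many elements as
there are indices `i < k` with `x + i * d ∈ A`. -/
theorem card_progression_inter {d : ℕ} (hd : 0 < d) (k x : ℕ) (A : Finset ℕ) :
    (((Finset.range k).image (fun i => x + i * d)) ∩ A).card =
      ((Finset.range k).filter (fun i => x + i * d ∈ A)).card := by
  rw [← Finset.filter_mem_eq_inter, Finset.filter_image, Finset.card_image_of_injective]
  intro i j hij
  exact Nat.eq_of_mul_eq_mul_right hd (Nat.add_left_cancel hij)

/-- Double counting of the incidences between `A` and the progressions of length `k` and
difference `d` inside `{1,…,N}`. -/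
theorem mul_card_le_sum_card_progression_inter {N k d : ℕ} (hd : 0 < d) {A : Finset ℕ}
    (hA : A ⊆ Finset.Icc 1 N) :
    k * A.card ≤ (∑ x ∈ (Finset.Icc 1 N).filter (fun x => x + (k - 1) * d ≤ N),
      (((Finset.range k).image (fun i => x + i * d)) ∩ A).card) + k * (2 * ((k - 1) * d)) := by
  simp_rw [card_progression_inter hd]
  have hswap := Finset.sum_card_bipartiteAbove_eq_sum_card_bipartiteBelow
    (s := Finset.range k) (t := (Finset.Icc 1 N).filter (fun x => x + (k - 1) * d ≤ N))
    (fun i x => x + i * d ∈ A)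
  simp only [Finset.bipartiteAbove, Finset.bipartiteBelow] at hswap
  rw [← hswap]
  have h : ∀ i ∈ Finset.range k, A.card ≤
      (((Finset.Icc 1 N).filter (fun x => x + (k - 1) * d ≤ N)).filter
        (fun x => x + i * d ∈ A)).card
        + 2 * ((k - 1) * d) := by
    intro i hi
    have hik := Finset.mem_range.1 hi
    exact card_le_card_shift_add hA (Nat.mul_le_mul_right d (by omega))
  simpa [Finset.sum_add_distrib] using Finset.sum_le_sum h

/-- If `f ≤ k` on `X`, then the sum of `f` is at most `k` times the number of points where
`c ≤ f`, plus `c` times the size of `X`. -/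
theorem sum_le_mul_card_filter_add {α : Type*} (X : Finset α) (f : α → ℝ) {k c : ℝ}
    (hc : 0 ≤ c) (hf : ∀ x ∈ X, f x ≤ k) :
    ∑ x ∈ X, f x ≤ k * ((X.filter (fun x => c ≤ f x)).card : ℝ) + c * (X.card : ℝ) := by
  have h : ∀ x ∈ X, f x ≤ (if c ≤ f x then k else 0) + c := by
    intro x hx
    have := hf x hx
    split_ifs <;> linarith
  refine (Finset.sum_le_sum h).trans (le_of_eq ?_)
  rw [Finset.sum_add_distrib, ← Finset.sum_filter, Finset.sum_const, Finset.sum_const,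
    nsmul_eq_mul, nsmul_eq_mul]
  ring

/-- Counting good progressions: if `A ⊆ {1,…,N}` has `|A| ≥ δN`, `k > 8`, `r ≥ 1` and
`r² < δN/k²`, then the number of `x` with `1 ≤ x`, `x + (k-1)r² ≤ N` for which the
progression `P_{x,r} = {x, x + r², …, x + (k-1)r²}` satisfies `|P_{x,r} ∩ A| ≥ δk/2`
is strictly greater than `δN/4`. -/
theorem many_good_progressions (N : ℕ) (hN : N.Prime) (δ : ℝ) (hδ0 : 0 < δ)
    (hδ1 : δ ≤ 1) (A : Finset ℕ) (hA : A ⊆ Finset.Icc 1 N)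
    (hAcard : δ * (N : ℝ) ≤ (A.card : ℝ))
    (k : ℕ) (hk : 8 < k) (r : ℕ) (hr : 0 < r)
    (hrsmall : (r : ℝ) ^ 2 < δ * (N : ℝ) / (k : ℝ) ^ 2) :
    δ * (N : ℝ) / 4 <
      (((Finset.Icc 1 N).filter (fun x =>
        x + (k - 1) * r ^ 2 ≤ N ∧
        δ * (k : ℝ) / 2 ≤
          ((((Finset.range k).image (fun i => x + i * r ^ 2)) ∩ A).card : ℝ))).card : ℝ) := by
  have hk' : (9 : ℝ) ≤ k := by exact_mod_cast hk
  have hk0 : (0 : ℝ) < k := by linarith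
  have hN0 : (0 : ℝ) < N := by exact_mod_cast hN.pos
  have hδN : 0 < δ * (N : ℝ) := mul_pos hδ0 hN0
  have hcount := mul_card_le_sum_card_progression_inter (k := k) (pow_pos hr 2) hA
  rw [← Finset.filter_filter]
  set X := (Finset.Icc 1 N).filter (fun x => x + (k - 1) * r ^ 2 ≤ N)
  have hX : (X.card : ℝ) ≤ N := by
    have := Finset.card_filter_le (Finset.Icc 1 N) (fun x => x + (k - 1) * r ^ 2 ≤ N)
    rw [Nat.card_Icc, Nat.add_sub_cancel] at this
    exact_mod_cast this
  have hsum := sum_le_mul_card_filter_add X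
    (fun x => ((((Finset.range k).image (fun i => x + i * r ^ 2)) ∩ A).card : ℝ))
    (k := k) (c := δ * k / 2) (by positivity) (by
      intro x _
      have h := (Finset.card_le_card (Finset.inter_subset_left (s₂ := A))).trans
        (Finset.card_image_le (s := Finset.range k) (f := fun i => x + i * r ^ 2))
      rw [Finset.card_range] at h
      exact_mod_cast h)
  have hcountR : (k : ℝ) * A.card ≤
      (∑ x ∈ X, ((((Finset.range k).image (fun i => x + i * r ^ 2)) ∩ A).card : ℝ))
        + k * (2 * (((k : ℝ) - 1) * (r : ℝ) ^ 2)) := by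
    have h : ((k - 1 : ℕ) : ℝ) = (k : ℝ) - 1 := by
      rw [Nat.cast_sub (by omega), Nat.cast_one]
    rw [← h]
    exact_mod_cast hcount
  have hloss : 9 * (((k : ℝ) - 1) * (r : ℝ) ^ 2) ≤ δ * N := by
    rw [lt_div_iff₀ (by positivity)] at hrsmall
    have h : 9 * ((k : ℝ) - 1) ≤ (k : ℝ) ^ 2 := by nlinarith
    nlinarith [mul_le_mul_of_nonneg_left h (sq_nonneg (r : ℝ))]
  have hXδ : δ * k / 2 * (X.card : ℝ) ≤ k * (δ * N / 2) := by
    calc δ * k / 2 * (X.card : ℝ) ≤ δ * k / 2 * N := by gcongr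
      _ = k * (δ * N / 2) := by ring
  set G := X.filter (fun x => δ * (k : ℝ) / 2 ≤
    ((((Finset.range k).image (fun i => x + i * r ^ 2)) ∩ A).card : ℝ))
  have hmain : (k : ℝ) * A.card ≤
      k * ((G.card : ℝ) + δ * N / 2 + 2 * (((k : ℝ) - 1) * (r : ℝ) ^ 2)) := by
    linarith
  have := le_of_mul_le_mul_left hmain hk0
  linarith
end

section
/- Let N be prime, σ > 0, α ∈ (0,1], and let f : Z_N → ℝ satisfy 0 ≤ f(x) ≤ 1 + σ for all x and Σ_{x ∈ Z_N} f(x) = αN. Then |{ x ∈ Z_N : (f∗f)(x) ≥ σαN }| ≥ (α − 3σ)N. -/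
open scoped Classical BigOperators

/-- If `f : ZMod N → ℝ` satisfies `0 ≤ f ≤ 1 + σ` and `Σ f = αN`, then the set of `x` where
the autoconvolution `(f∗f)(x) = Σ_y f(y) f(x-y)` is at least `σαN` has size at least
`(α - 3σ)N`. -/
theorem autoconvolution_support_lower_bound (N : ℕ) (hN : N.Prime) [NeZero N]
    (σ α : ℝ) (hσ : 0 < σ) (hα0 : 0 < α) (hα1 : α ≤ 1)
    (f : ZMod N → ℝ) (hf : ∀ x, 0 ≤ f x ∧ f x ≤ 1 + σ)
    (hsum : ∑ x : ZMod N, f x = α * (N : ℝ)) :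
    (α - 3 * σ) * (N : ℝ) ≤
      (((Finset.univ : Finset (ZMod N)).filter (fun x =>
        σ * α * (N : ℝ) ≤ ∑ y : ZMod N, f y * f (x - y))).card : ℝ) := by
  set S := (Finset.univ : Finset (ZMod N)).filter (fun x =>
    σ * α * (N : ℝ) ≤ ∑ y : ZMod N, f y * f (x - y)) with hS
  have hNpos : (0 : ℝ) < N := by exact_mod_cast hN.pos
  have hmass : 0 < α * (N : ℝ) := mul_pos hα0 hNpos
  have htotal : ∑ x : ZMod N, ∑ y : ZMod N, f y * f (x - y) = (α * N) * (α * N) := by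
    rw [Finset.sum_comm]
    have hshift (y : ZMod N) : ∑ x : ZMod N, f y * f (x - y) = f y * (α * N) := by
      rw [← Finset.mul_sum, ← hsum]
      exact congrArg _ (Equiv.sum_comp (Equiv.subRight y) f)
    simp only [hshift, ← Finset.sum_mul, hsum]
  have hpoint (x : ZMod N) :
      ∑ y : ZMod N, f y * f (x - y) ≤ (α * N) * (σ + if x ∈ S then 1 else 0) := by
    split_ifs with hx
    · rw [← hsum, Finset.sum_mul]
      exact Finset.sum_le_sum fun y _ =>
        mul_le_mul_of_nonneg_left (by linarith [(hf (x - y)).2]) (hf y).1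
    · have hlt : ∑ y : ZMod N, f y * f (x - y) < σ * α * N := by
        simpa [hS] using hx
      linarith
  have hbound : (α * N) * (α * N) ≤ (α * N) * (σ * N + (S.card : ℝ)) := by
    rw [← htotal]
    refine (Finset.sum_le_sum fun x _ => hpoint x).trans_eq ?_
    rw [← Finset.mul_sum, Finset.sum_add_distrib]
    simp [ZMod.card, mul_comm]
  have hcard := le_of_mul_le_mul_left hbound hmass
  nlinarith [mul_pos hσ hNpos]
end
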